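/- arXiv:1303.1998 — 2 statements merged into one kernel-verified Lean document; each statement's English description precedes it below -/
import Mathlib

section
/- Let q be a prime power, f ∈ F_q[t][x] with deg_x f = d ≥ 1 which is separable and squarefree as a polynomial in x over F_q(t), and ℓ ∈ F_q[t] monic irreducible not dividing the gcd of the coefficients of f. Assume that every affine and every projective root of f modulo ℓ is simple (i.e., is a simple root of the reduction of f, respectively of its reversed polynomial, modulo ℓ), and let n_ℓ be the total number of affine and projective roots of f modulo ℓ. Then α_ℓ(f) = (deg ℓ/(Norm(ℓ) − 1)) · ( 1 − (Norm(ℓ)/(Norm(ℓ)+1)) · n_ℓ ). -/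
open Polynomial Filter

/-- The homogenization `F(a,b)` of `f ∈ F_q[t][x]` evaluated at polynomials `a, b`. -/
noncomputable def homogEval {Fq : Type*} [Field Fq] (f : Polynomial (Polynomial Fq))
    (a b : Polynomial Fq) : Polynomial Fq :=
  ∑ i ∈ Finset.range (f.natDegree + 1), f.coeff i * a ^ i * b ^ (f.natDegree - i)

section AlphaEll

open Classical in
/-- The finite set of polynomials of degree less than `M`. -/
noncomputable def polysLT (F : Type*) [Field F] [Fintype F] (M : ℕ) : Finset F[X] :=
  (Finset.univ : Finset (Fin M → F)).map
    ((degreeLTEquiv F M).symm.toEquiv.toEmbedding.trans (Function.Embedding.subtype _))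

variable {F : Type*} [Field F] [Fintype F]

lemma mem_polysLT {M : ℕ} {a : F[X]} : a ∈ polysLT F M ↔ a.degree < M := by
  rw [← mem_degreeLT, polysLT, Finset.mem_map]
  constructor
  · rintro ⟨v, -, rfl⟩
    exact ((degreeLTEquiv F M).symm v).2
  · intro h
    exact ⟨degreeLTEquiv F M ⟨a, h⟩, Finset.mem_univ _, by simp⟩

lemma card_polysLT (M : ℕ) : (polysLT F M).card = Fintype.card F ^ M := by
  classical
  rw [polysLT, Finset.card_map, Finset.card_univ, Fintype.card_fun, Fintype.card_fin]

lemma mul_mem_polysLT {M : ℕ} {g s : F[X]} (hg : g ≠ 0) :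
    g * s ∈ polysLT F M ↔ s ∈ polysLT F (M - g.natDegree) := by
  rw [mem_polysLT, mem_polysLT]
  rcases eq_or_ne s 0 with rfl | hs
  · simp
  · rw [degree_eq_natDegree (mul_ne_zero hg hs), degree_eq_natDegree hs, natDegree_mul hg hs]
    norm_cast
    omega

open Classical in
lemma card_filter_dvd_sub {M : ℕ} {g : F[X]} (hg : g.Monic) (hM : g.natDegree ≤ M) (c : F[X]) :
    {a ∈ polysLT F M | g ∣ a - c}.card = Fintype.card F ^ (M - g.natDegree) := by
  rw [← card_polysLT]
  symm
  have hmem : c %ₘ g ∈ polysLT F M := by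
    rw [mem_polysLT]
    refine (degree_modByMonic_lt c hg).trans_le ?_
    rw [degree_eq_natDegree hg.ne_zero]
    exact_mod_cast hM
  have hc : g ∣ c %ₘ g - c :=
    ⟨-(c /ₘ g), by linear_combination modByMonic_add_div c g⟩
  have hadd : ∀ x y : F[X], x ∈ polysLT F M → y ∈ polysLT F M →
      x + y ∈ polysLT F M ∧ x - y ∈ polysLT F M := by
    intro x y hx hy
    rw [mem_polysLT, ← mem_degreeLT] at *
    rw [mem_polysLT, ← mem_degreeLT]
    exact ⟨add_mem hx hy, sub_mem hx hy⟩
  refine Finset.card_bij (fun s _ => g * s + c %ₘ g) ?_ ?_ ?_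
  · intro s hs
    rw [Finset.mem_filter]
    refine ⟨(hadd _ _ ((mul_mem_polysLT hg.ne_zero).2 hs) hmem).1, ?_⟩
    rw [add_sub_assoc]
    exact dvd_add (dvd_mul_right _ _) hc
  · intro s _ s' _ h
    exact mul_left_cancel₀ hg.ne_zero (add_right_cancel h)
  · intro a ha
    rw [Finset.mem_filter] at ha
    obtain ⟨s, hs⟩ : g ∣ a - c %ₘ g := by
      have := dvd_sub ha.2 hc
      rwa [sub_sub_sub_cancel_right] at this
    refine ⟨s, ?_, ?_⟩
    · rw [← mul_mem_polysLT hg.ne_zero, ← hs]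
      exact (hadd _ _ ha.1 hmem).2
    · simp only [← hs, sub_add_cancel]

open Classical in
lemma card_filter_dvd {M : ℕ} {g : F[X]} (hg : g.Monic) :
    {a ∈ polysLT F M | g ∣ a}.card = Fintype.card F ^ (M - g.natDegree) := by
  rw [← card_polysLT]
  symm
  refine Finset.card_bij (fun s _ => g * s) ?_ ?_ ?_
  · intro s hs
    rw [Finset.mem_filter]
    exact ⟨(mul_mem_polysLT hg.ne_zero).2 hs, dvd_mul_right _ _⟩
  · intro s _ s' _ h
    exact mul_left_cancel₀ hg.ne_zero h
  · intro a ha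
    rw [Finset.mem_filter] at ha
    obtain ⟨h, s, rfl⟩ := ha
    exact ⟨s, (mul_mem_polysLT hg.ne_zero).1 h, rfl⟩


/-- Hensel lifting: above a simple root modulo `ℓ` there is exactly one root modulo `ℓ ^ k`. -/
lemma exists_unique_lift {R : Type*} [CommRing R] [IsDomain R] [IsPrincipalIdealRing R] {ℓ : R}
    (hℓ : Irreducible ℓ) (g : R[X]) {r : R} (hr : ℓ ∣ g.eval r) (hr' : ¬ ℓ ∣ g.derivative.eval r)
    {k : ℕ} (hk : 1 ≤ k) : ∃ c, ∀ a, (ℓ ∣ a - r ∧ ℓ ^ k ∣ g.eval a) ↔ ℓ ^ k ∣ a - c := by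
  induction k, hk using Nat.le_induction with
  | base =>
    refine ⟨r, fun a => ?_⟩
    rw [pow_one, and_iff_left_iff_imp]
    intro h
    have := h.trans (sub_dvd_eval_sub a r g)
    exact (dvd_iff_dvd_of_dvd_sub this).2 hr
  | succ k hk ih =>
    obtain ⟨c, hc⟩ := ih
    obtain ⟨hcr, e, he⟩ := (hc c).2 (by simp)
    have hd : ¬ ℓ ∣ g.derivative.eval c := by
      have := hcr.trans (sub_dvd_eval_sub c r g.derivative)
      rwa [dvd_iff_dvd_of_dvd_sub this]
    obtain ⟨u, v, huv⟩ := (hℓ.coprime_iff_not_dvd).2 hd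
    have hpow : ℓ ^ k ≠ 0 := pow_ne_zero _ hℓ.ne_zero
    refine ⟨c + ℓ ^ k * (-(v * e)), fun a => ?_⟩
    have key : ∀ s, ℓ ^ (k + 1) ∣ g.eval (c + ℓ ^ k * s) ↔ ℓ ∣ s + v * e := by
      intro s
      obtain ⟨w, hw⟩ := binomExpansion g c (ℓ ^ k * s)
      obtain ⟨j, rfl⟩ : ∃ j, k = j + 1 := ⟨k - 1, by omega⟩
      have h1 : g.eval (c + ℓ ^ (j + 1) * s) =
          ℓ ^ (j + 1) * (e + g.derivative.eval c * s + ℓ * (w * ℓ ^ j * s ^ 2)) := by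
        rw [hw, he]; ring
      rw [h1, pow_succ, mul_dvd_mul_iff_left hpow, dvd_add_left (dvd_mul_right _ _)]
      constructor
      · rintro ⟨z, hz⟩
        exact ⟨v * z + u * s, by linear_combination v * hz - s * huv⟩
      · rintro ⟨z, hz⟩
        exact ⟨g.derivative.eval c * z + u * e,
          by linear_combination g.derivative.eval c * hz - e * huv⟩
    constructor
    · rintro ⟨h1, h2⟩
      obtain ⟨s, hs⟩ := (hc a).1 ⟨h1, (pow_dvd_pow ℓ k.le_succ).trans h2⟩
      obtain rfl : a = c + ℓ ^ k * s := by linear_combination hs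
      obtain ⟨z, hz⟩ := (key s).1 h2
      exact ⟨z, by rw [pow_succ]; linear_combination ℓ ^ k * hz⟩
    · rintro ⟨z, hz⟩
      obtain rfl : a = c + ℓ ^ k * (ℓ * z - v * e) := by rw [pow_succ] at hz; linear_combination hz
      refine ⟨((hc _).2 ?_).1, (key _).2 ⟨z, by ring⟩⟩
      exact ⟨ℓ * z - v * e, by ring⟩

omit [Fintype F] in
lemma homogEval_mul_mul (f : F[X][X]) (u a b : F[X]) :
    homogEval f (u * a) (u * b) = u ^ f.natDegree * homogEval f a b := by
  rw [homogEval, homogEval, Finset.mul_sum]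
  refine Finset.sum_congr rfl fun i hi => ?_
  have hi : i ≤ f.natDegree := by simpa [Nat.lt_succ_iff] using hi
  obtain ⟨j, hj⟩ := Nat.exists_eq_add_of_le hi
  rw [hj, Nat.add_sub_cancel_left]
  ring

omit [Fintype F] in
lemma dvd_homogEval_sub (f : F[X][X]) {g a b a' b' : F[X]} (ha : g ∣ a - a') (hb : g ∣ b - b') :
    g ∣ homogEval f a b - homogEval f a' b' := by
  rw [homogEval, homogEval, ← Finset.sum_sub_distrib]
  refine Finset.dvd_sum fun i _ => ?_
  have h1 := ha.trans (sub_dvd_pow_sub_pow a a' i)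
  have h2 := hb.trans (sub_dvd_pow_sub_pow b b' (f.natDegree - i))
  have : f.coeff i * a ^ i * b ^ (f.natDegree - i) - f.coeff i * a' ^ i * b' ^ (f.natDegree - i) =
      f.coeff i * b ^ (f.natDegree - i) * (a ^ i - a' ^ i) +
      f.coeff i * a' ^ i * (b ^ (f.natDegree - i) - b' ^ (f.natDegree - i)) := by ring
  rw [this]
  exact dvd_add (h1.mul_left _) (h2.mul_left _)

omit [Fintype F] in
lemma homogEval_one_right (f : F[X][X]) (a : F[X]) : homogEval f a 1 = f.eval a := by
  simp [homogEval, eval_eq_sum_range]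

omit [Fintype F] in
lemma homogEval_one_left (f : F[X][X]) (b : F[X]) :
    homogEval f 1 b = (reflect f.natDegree f).eval b := by
  rw [eval_eq_sum_range' (n := f.natDegree + 1), homogEval,
    ← Finset.sum_flip (fun i => (reflect f.natDegree f).coeff i * b ^ i)]
  · refine Finset.sum_congr rfl fun i hi => ?_
    have hi : i ≤ f.natDegree := by simpa [Nat.lt_succ_iff] using hi
    rw [coeff_reflect, revAt_le (Nat.sub_le _ _), Nat.sub_sub_self hi, one_pow, mul_one]
  · exact Nat.lt_succ_of_le (natDegree_reflect_le.trans (by simp))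

omit [Fintype F] in
lemma dvd_homogEval_iff (f : F[X][X]) {g u a b a' b' : F[X]} (hu : IsCoprime g u)
    (ha : g ∣ u * a - a') (hb : g ∣ u * b - b') :
    g ∣ homogEval f a b ↔ g ∣ homogEval f a' b' := by
  rw [← dvd_iff_dvd_of_dvd_sub (dvd_homogEval_sub f ha hb), homogEval_mul_mul]
  exact ⟨fun h => h.mul_left _, fun h => (hu.pow_right).dvd_of_dvd_mul_left h⟩

open Classical in
lemma card_filter_lift {ℓ : F[X]} (hmonic : ℓ.Monic) (hirr : Irreducible ℓ) (g : F[X][X])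
    (S : Finset F[X]) (hdeg : ∀ r ∈ S, r.degree < ℓ.degree) (hroot : ∀ r ∈ S, ℓ ∣ g.eval r)
    (hsimple : ∀ r ∈ S, ¬ ℓ ∣ g.derivative.eval r) {k M : ℕ} (hk : 1 ≤ k)
    (hkM : k * ℓ.natDegree ≤ M) {v v' : F[X]} (hv : ℓ ^ k ∣ v * v' - 1) :
    {a ∈ polysLT F M | (∃ r ∈ S, ℓ ∣ v' * a - r) ∧ ℓ ^ k ∣ g.eval (v' * a)}.card =
      S.card * Fintype.card F ^ (M - k * ℓ.natDegree) := by
  choose! c hc using fun r (hr : r ∈ S) =>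
    exists_unique_lift hirr g (hroot r hr) (hsimple r hr) hk
  have hℓk : ℓ ∣ ℓ ^ k := dvd_pow_self _ (by omega)
  have hset : {a ∈ polysLT F M | (∃ r ∈ S, ℓ ∣ v' * a - r) ∧ ℓ ^ k ∣ g.eval (v' * a)} =
      S.biUnion fun r => {a ∈ polysLT F M | ℓ ^ k ∣ a - v * c r} := by
    ext a
    simp only [Finset.mem_filter, Finset.mem_biUnion]
    have hiff : ∀ r, ℓ ^ k ∣ v' * a - c r ↔ ℓ ^ k ∣ a - v * c r := by
      intro r
      constructor
      · intro h
        have : a - v * c r = v * (v' * a - c r) - a * (v * v' - 1) := by ring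
        rw [this]
        exact dvd_sub (h.mul_left _) (hv.mul_left _)
      · intro h
        have : v' * a - c r = v' * (a - v * c r) + c r * (v * v' - 1) := by ring
        rw [this]
        exact dvd_add (h.mul_left _) (hv.mul_left _)
    constructor
    · rintro ⟨ha, ⟨r, hr, h1⟩, h2⟩
      exact ⟨r, hr, ha, (hiff r).1 ((hc r hr _).1 ⟨h1, h2⟩)⟩
    · rintro ⟨r, hr, ha, h⟩
      have := (hc r hr _).2 ((hiff r).2 h)
      exact ⟨ha, ⟨r, hr, this.1⟩, this.2⟩
  rw [hset, Finset.card_biUnion, Finset.sum_congr rfl fun r _ => ?_, Finset.sum_const, smul_eq_mul]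
  · have := card_filter_dvd_sub (hmonic.pow k) (by rwa [hmonic.natDegree_pow]) (v * c r) (M := M)
    rwa [hmonic.natDegree_pow] at this
  · intro r hr r' hr' hne
    rw [Function.onFun, Finset.disjoint_left]
    intro a ha ha'
    rw [Finset.mem_filter] at ha ha'
    apply hne
    have h1 := ((hc r hr (c r)).2 (by simp)).1
    have h2 := ((hc r' hr' (c r')).2 (by simp)).1
    have h3 : ℓ ∣ v * c r - v * c r' := by
      have := hℓk.trans (dvd_sub ha'.2 ha.2)
      rwa [sub_sub_sub_cancel_left] at this
    have h4 : ℓ ∣ r - r' := by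
      have : r - r' = v' * (v * c r - v * c r') - (c r - c r') * (v * v' - 1)
        - (c r - r) + (c r' - r') := by ring
      rw [this]
      exact dvd_add (dvd_sub (dvd_sub (h3.mul_left _) ((hℓk.trans hv).mul_left _)) h1) h2
    exact sub_eq_zero.1 (eq_zero_of_dvd_of_degree_lt h4
      ((degree_sub_le _ _).trans_lt (max_lt (hdeg r hr) (hdeg r' hr'))))

open Classical in
lemma card_affine {ℓ : F[X]} (hmonic : ℓ.Monic) (hirr : Irreducible ℓ) (f : F[X][X])
    (S : Finset F[X]) (hS : ∀ r, r ∈ S ↔ r.degree < ℓ.degree ∧ ℓ ∣ f.eval r)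
    (hsimple : ∀ r ∈ S, ¬ ℓ ∣ f.derivative.eval r) {k M : ℕ} (hk : 1 ≤ k)
    (hkM : k * ℓ.natDegree ≤ M) {b : F[X]} (hb : ¬ ℓ ∣ b) :
    {a ∈ polysLT F M | ℓ ^ k ∣ homogEval f a b}.card =
      S.card * Fintype.card F ^ (M - k * ℓ.natDegree) := by
  have hcop : IsCoprime (ℓ ^ k) b := (hirr.coprime_iff_not_dvd.2 hb).pow_left
  obtain ⟨u, v, huv⟩ := hcop
  have hv : ℓ ^ k ∣ b * v - 1 := ⟨-u, by linear_combination huv⟩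
  rw [← card_filter_lift hmonic hirr f S (fun r hr => ((hS r).1 hr).1)
    (fun r hr => ((hS r).1 hr).2) hsimple hk hkM hv]
  congr 1
  refine Finset.filter_congr fun a _ => ?_
  have hiff : ℓ ^ k ∣ homogEval f a b ↔ ℓ ^ k ∣ f.eval (v * a) := by
    rw [← homogEval_one_right]
    refine dvd_homogEval_iff f (u := v) ⟨u, b, by linear_combination huv⟩ (by simp) ?_
    rwa [mul_comm]
  rw [hiff, iff_and_self]
  intro h
  have hmod : ℓ ∣ v * a - (v * a) %ₘ ℓ :=
    ⟨(v * a) /ₘ ℓ, by linear_combination -modByMonic_add_div (v * a) ℓ⟩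
  refine ⟨(v * a) %ₘ ℓ, (hS _).2 ⟨degree_modByMonic_lt _ hmonic, ?_⟩, hmod⟩
  exact (dvd_iff_dvd_of_dvd_sub (hmod.trans (sub_dvd_eval_sub _ _ f))).1
    ((dvd_pow_self _ (by omega)).trans h)

open Classical in
lemma card_projective {ℓ : F[X]} (hmonic : ℓ.Monic) (hirr : Irreducible ℓ) (f : F[X][X])
    (S : Finset F[X]) (hS : ∀ r, r ∈ S ↔ r.degree < ℓ.degree ∧ ℓ ∣ r ∧ ℓ ∣ homogEval f 1 r)
    (hsimple : ∀ r ∈ S, ¬ ℓ ∣ (reflect f.natDegree f).derivative.eval r) {k M : ℕ} (hk : 1 ≤ k)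
    (hkM : k * ℓ.natDegree ≤ M) {a : F[X]} (ha : ¬ ℓ ∣ a) :
    {b ∈ polysLT F M | ℓ ∣ b ∧ ℓ ^ k ∣ homogEval f a b}.card =
      S.card * Fintype.card F ^ (M - k * ℓ.natDegree) := by
  have hcop : IsCoprime (ℓ ^ k) a := (hirr.coprime_iff_not_dvd.2 ha).pow_left
  obtain ⟨u, v, huv⟩ := hcop
  have hv : ℓ ^ k ∣ a * v - 1 := ⟨-u, by linear_combination huv⟩
  have hℓk : ℓ ∣ ℓ ^ k := dvd_pow_self _ (by omega)
  rw [← card_filter_lift hmonic hirr (reflect f.natDegree f) S (fun r hr => ((hS r).1 hr).1)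
    (fun r hr => homogEval_one_left f r ▸ ((hS r).1 hr).2.2) hsimple hk hkM hv]
  congr 1
  refine Finset.filter_congr fun b _ => ?_
  have hiff : ℓ ^ k ∣ homogEval f a b ↔ ℓ ^ k ∣ (reflect f.natDegree f).eval (v * b) := by
    rw [← homogEval_one_left]
    refine dvd_homogEval_iff f (u := v) ⟨u, a, by linear_combination huv⟩ ?_ (by simp)
    rwa [mul_comm]
  rw [hiff]
  refine and_congr_left fun h => ⟨fun hb => ⟨0, ?_, by simpa using hb.mul_left v⟩, ?_⟩
  · have h0 : ℓ ∣ homogEval f 1 (v * b) := homogEval_one_left f _ ▸ hℓk.trans h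
    refine (hS _).2 ⟨?_, dvd_zero _, ?_⟩
    · rw [degree_zero, bot_lt_iff_ne_bot, Ne, degree_eq_bot]
      exact hirr.ne_zero
    · refine (dvd_iff_dvd_of_dvd_sub (dvd_homogEval_sub f (by simp) ?_)).1 h0
      simpa using hb.mul_left v
  · rintro ⟨r, hr, hrb⟩
    have : ℓ ∣ v * b := (dvd_iff_dvd_of_dvd_sub hrb).2 ((hS r).1 hr).2.1
    refine (hirr.prime.dvd_or_dvd this).resolve_left fun hlv => ?_
    apply hirr.not_isUnit
    rw [isUnit_iff_dvd_one, ← huv]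
    exact dvd_add (hℓk.mul_left _) (hlv.mul_right _)

/-- The pairs of polynomials of degree less than `M`, not both divisible by `ℓ`. -/
noncomputable def primitivePairs (ℓ : F[X]) (M : ℕ) : Finset (F[X] × F[X]) :=
  open Classical in {p ∈ polysLT F M ×ˢ polysLT F M | ¬ (ℓ ∣ p.1 ∧ ℓ ∣ p.2)}

open Classical in
lemma card_filter_not_dvd {ℓ : F[X]} (hmonic : ℓ.Monic) (M : ℕ) :
    ({a ∈ polysLT F M | ¬ ℓ ∣ a}.card : ℝ) =
      (Fintype.card F : ℝ) ^ M - (Fintype.card F : ℝ) ^ (M - ℓ.natDegree) := by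
  have h := Finset.card_filter_add_card_filter_not (s := polysLT F M) (fun a => ℓ ∣ a)
  rw [card_polysLT, card_filter_dvd hmonic] at h
  rw [eq_sub_iff_add_eq', ← Nat.cast_pow, ← Nat.cast_pow, ← h, Nat.cast_add]

lemma card_primitivePairs {ℓ : F[X]} (hmonic : ℓ.Monic) (M : ℕ) :
    ((primitivePairs ℓ M).card : ℝ) = ((Fintype.card F : ℝ) ^ M) ^ 2 -
      ((Fintype.card F : ℝ) ^ (M - ℓ.natDegree)) ^ 2 := by
  classical
  have h := Finset.card_filter_add_card_filter_not (s := polysLT F M ×ˢ polysLT F M)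
    (fun p => ℓ ∣ p.1 ∧ ℓ ∣ p.2)
  have h1 := Finset.filter_product (s := polysLT F M) (t := polysLT F M) (fun a => ℓ ∣ a)
    (fun a => ℓ ∣ a)
  rw [h1, Finset.card_product, Finset.card_product, card_polysLT, card_filter_dvd hmonic] at h
  rw [eq_sub_iff_add_eq', ← Nat.cast_pow, ← Nat.cast_pow, ← Nat.cast_pow, ← Nat.cast_pow, sq, sq,
    ← h, Nat.cast_add, primitivePairs]

open Classical in
lemma card_filter_primitivePairs {ℓ : F[X]} (hmonic : ℓ.Monic) (hirr : Irreducible ℓ)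
    (f : F[X][X]) (S T : Finset F[X])
    (hS : ∀ r, r ∈ S ↔ r.degree < ℓ.degree ∧ ℓ ∣ f.eval r)
    (hS' : ∀ r ∈ S, ¬ ℓ ∣ f.derivative.eval r)
    (hT : ∀ r, r ∈ T ↔ r.degree < ℓ.degree ∧ ℓ ∣ r ∧ ℓ ∣ homogEval f 1 r)
    (hT' : ∀ r ∈ T, ¬ ℓ ∣ (reflect f.natDegree f).derivative.eval r) {k M : ℕ} (hk : 1 ≤ k)
    (hkM : k * ℓ.natDegree ≤ M) :
    ({p ∈ primitivePairs ℓ M | ℓ ^ k ∣ homogEval f p.1 p.2}.card : ℝ) =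
      (S.card + T.card) * (((Fintype.card F : ℝ) ^ M) - (Fintype.card F : ℝ) ^ (M - ℓ.natDegree)) *
        (Fintype.card F : ℝ) ^ (M - k * ℓ.natDegree) := by
  have h1 : {p ∈ primitivePairs ℓ M | ℓ ^ k ∣ homogEval f p.1 p.2 ∧ ¬ ℓ ∣ p.2}.card =
      ∑ b ∈ polysLT F M with ¬ ℓ ∣ b, S.card * Fintype.card F ^ (M - k * ℓ.natDegree) := by
    have hmaps : ∀ p ∈ {p ∈ primitivePairs ℓ M | ℓ ^ k ∣ homogEval f p.1 p.2 ∧ ¬ ℓ ∣ p.2},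
        p.2 ∈ {b ∈ polysLT F M | ¬ ℓ ∣ b} := by
      intro p
      simp only [primitivePairs, Finset.mem_filter, Finset.mem_product]
      tauto
    rw [Finset.card_eq_sum_card_fiberwise hmaps]
    refine Finset.sum_congr rfl fun b hb => ?_
    rw [Finset.mem_filter] at hb
    rw [← card_affine hmonic hirr f S hS hS' hk hkM hb.2]
    refine Finset.card_bij (fun p _ => p.1) ?_ ?_ ?_
    · intro p
      simp only [primitivePairs, Finset.mem_filter, Finset.mem_product]
      rintro ⟨h, rfl⟩
      tauto
    · rintro ⟨a, b⟩ h ⟨a', b'⟩ h' rfl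
      simp only [Finset.mem_filter] at h h'
      rw [h.2, h'.2]
    · intro a ha
      refine ⟨(a, b), ?_, rfl⟩
      simp only [primitivePairs, Finset.mem_filter, Finset.mem_product] at ha ⊢
      tauto
  have h2 : {p ∈ primitivePairs ℓ M | ℓ ^ k ∣ homogEval f p.1 p.2 ∧ ℓ ∣ p.2}.card =
      ∑ a ∈ polysLT F M with ¬ ℓ ∣ a, T.card * Fintype.card F ^ (M - k * ℓ.natDegree) := by
    have hmaps : ∀ p ∈ {p ∈ primitivePairs ℓ M | ℓ ^ k ∣ homogEval f p.1 p.2 ∧ ℓ ∣ p.2},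
        p.1 ∈ {b ∈ polysLT F M | ¬ ℓ ∣ b} := by
      intro p
      simp only [primitivePairs, Finset.mem_filter, Finset.mem_product]
      tauto
    rw [Finset.card_eq_sum_card_fiberwise hmaps]
    refine Finset.sum_congr rfl fun a ha => ?_
    rw [Finset.mem_filter] at ha
    rw [← card_projective hmonic hirr f T hT hT' hk hkM ha.2]
    refine Finset.card_bij (fun p _ => p.2) ?_ ?_ ?_
    · intro p
      simp only [primitivePairs, Finset.mem_filter, Finset.mem_product]
      rintro ⟨h, rfl⟩
      tauto
    · rintro ⟨a, b⟩ h ⟨a', b'⟩ h' rfl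
      simp only [Finset.mem_filter] at h h'
      rw [h.2, h'.2]
    · intro b hb
      refine ⟨(a, b), ?_, rfl⟩
      simp only [primitivePairs, Finset.mem_filter, Finset.mem_product] at hb ⊢
      tauto
  have h3 := Finset.card_filter_add_card_filter_not
    (s := {p ∈ primitivePairs ℓ M | ℓ ^ k ∣ homogEval f p.1 p.2}) (fun p => ℓ ∣ p.2)
  rw [Finset.filter_filter, Finset.filter_filter, h1, h2, Finset.sum_const, Finset.sum_const] at h3
  rw [← h3, ← card_filter_not_dvd hmonic]
  push_cast
  simp only [smul_eq_mul, Nat.cast_mul, Nat.cast_pow]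
  ring

/-- The coprime pairs of polynomials of degree less than `M`. -/
noncomputable def coprimePairs (F : Type*) [Field F] [Fintype F] (M : ℕ) : Finset (F[X] × F[X]) :=
  open Classical in {p ∈ polysLT F M ×ˢ polysLT F M | IsCoprime p.1 p.2}

/-- The monic polynomials of degree less than `M`. -/
noncomputable def monicsLT (F : Type*) [Field F] [Fintype F] (M : ℕ) : Finset F[X] :=
  open Classical in {g ∈ polysLT F M | g.Monic}

omit [Fintype F] in
lemma exists_monic_mul_isCoprime {a b : F[X]} (h : ¬ (a = 0 ∧ b = 0)) :
    ∃ g a' b' : F[X], g.Monic ∧ IsCoprime a' b' ∧ a = g * a' ∧ b = g * b' := by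
  classical
  obtain ⟨a', ha⟩ := EuclideanDomain.gcd_dvd_left a b
  obtain ⟨b', hb⟩ := EuclideanDomain.gcd_dvd_right a b
  have hbez := EuclideanDomain.gcd_eq_gcd_ab a b
  have hd : EuclideanDomain.gcd a b ≠ 0 := fun h0 => h (EuclideanDomain.gcd_eq_zero_iff.1 h0)
  set d := EuclideanDomain.gcd a b
  have hlc : C d.leadingCoeff * C d.leadingCoeff⁻¹ = 1 := by
    rw [← C_mul, mul_inv_cancel₀ (leadingCoeff_ne_zero.2 hd), C_1]
  have hcop : IsCoprime a' b' := by
    refine ⟨EuclideanDomain.gcdA a b, EuclideanDomain.gcdB a b, mul_left_cancel₀ hd ?_⟩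
    rw [mul_one]
    linear_combination -EuclideanDomain.gcdA a b * ha - EuclideanDomain.gcdB a b * hb - hbez
  have hu : IsUnit (C d.leadingCoeff) := isUnit_C.2 (leadingCoeff_ne_zero.2 hd).isUnit
  refine ⟨d * C d.leadingCoeff⁻¹, C d.leadingCoeff * a', C d.leadingCoeff * b',
    monic_mul_leadingCoeff_inv hd, ?_, ?_, ?_⟩
  · exact (isCoprime_mul_unit_left hu a' b').2 hcop
  · linear_combination ha - d * a' * hlc
  · linear_combination hb - d * b' * hlc

lemma sum_primitivePairs {ℓ : F[X]} (w : F[X] × F[X] → ℝ)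
    (hw : ∀ g a b : F[X], g.Monic → ¬ ℓ ∣ g → w (g * a, g * b) = w (a, b)) (M : ℕ) :
    ∑ p ∈ primitivePairs ℓ M, w p =
      open Classical in ∑ g ∈ monicsLT F M with ¬ ℓ ∣ g,
        ∑ p ∈ coprimePairs F (M - g.natDegree), w p := by
  classical
  rw [Finset.sum_sigma']
  symm
  refine Finset.sum_bij (fun x _ => (x.1 * x.2.1, x.1 * x.2.2)) ?_ ?_ ?_ ?_
  · rintro ⟨g, a, b⟩ h
    simp only [monicsLT, coprimePairs, primitivePairs, Finset.mem_sigma, Finset.mem_filter,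
      Finset.mem_product] at h ⊢
    obtain ⟨⟨⟨-, hg⟩, hℓ⟩, ⟨ha, hb⟩, u, v, huv⟩ := h
    refine ⟨⟨(mul_mem_polysLT hg.ne_zero).2 ha, (mul_mem_polysLT hg.ne_zero).2 hb⟩,
      fun hdvd => hℓ ?_⟩
    have : g = u * (g * a) + v * (g * b) := by linear_combination -g * huv
    rw [this]
    exact dvd_add (hdvd.1.mul_left _) (hdvd.2.mul_left _)
  · rintro ⟨g, a, b⟩ h ⟨g', a', b'⟩ h' heq
    simp only [monicsLT, coprimePairs, Finset.mem_sigma, Finset.mem_filter,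
      Finset.mem_product, Prod.mk.injEq] at h h' heq
    obtain ⟨⟨⟨-, hg⟩, -⟩, -, u, v, huv⟩ := h
    obtain ⟨⟨⟨-, hg'⟩, -⟩, -, u', v', huv'⟩ := h'
    obtain rfl : g = g' := by
      refine eq_of_monic_of_associated hg hg' (associated_of_dvd_dvd ?_ ?_)
      · exact ⟨u' * a + v' * b, by linear_combination -g' * huv' - u' * heq.1 - v' * heq.2⟩
      · exact ⟨u * a' + v * b', by linear_combination -g * huv + u * heq.1 + v * heq.2⟩
    rw [mul_left_cancel₀ hg.ne_zero heq.1, mul_left_cancel₀ hg.ne_zero heq.2]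
  · rintro ⟨x, y⟩ h
    simp only [primitivePairs, Finset.mem_filter, Finset.mem_product] at h
    obtain ⟨⟨hx, hy⟩, hprim⟩ := h
    have h0 : ¬ (x = 0 ∧ y = 0) := by
      rintro ⟨rfl, rfl⟩
      simp at hprim
    obtain ⟨g, a, b, hg, hcop, rfl, rfl⟩ := exists_monic_mul_isCoprime h0
    refine ⟨⟨g, a, b⟩, ?_, rfl⟩
    rw [mul_mem_polysLT hg.ne_zero] at hx hy
    simp only [monicsLT, coprimePairs, Finset.mem_sigma, Finset.mem_filter, Finset.mem_product]
    refine ⟨⟨⟨?_, hg⟩, fun hdvd => hprim ⟨hdvd.mul_right _, hdvd.mul_right _⟩⟩, ⟨hx, hy⟩, hcop⟩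
    rw [mem_polysLT, degree_eq_natDegree hg.ne_zero]
    by_contra! hM
    have hM : M - g.natDegree = 0 := Nat.sub_eq_zero_of_le (by exact_mod_cast hM)
    have hzero : ∀ s ∈ polysLT F 0, s = 0 := by
      intro s hs
      rw [mem_polysLT, degree_lt_iff_coeff_zero] at hs
      exact Polynomial.ext fun n => hs n n.zero_le
    rw [hM] at hx hy
    exact h0 (by simp [hzero _ hx, hzero _ hy])
  · rintro ⟨g, a, b⟩ h
    simp only [monicsLT, Finset.mem_sigma, Finset.mem_filter] at h
    exact (hw g a b h.1.1.2 h.1.2).symm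

lemma sum_monicsLT_dvd {ℓ : F[X]} (hmonic : ℓ.Monic) (W : ℕ → ℝ) (M : ℕ) :
    (open Classical in ∑ g ∈ monicsLT F M with ℓ ∣ g, W (M - g.natDegree)) =
      ∑ g ∈ monicsLT F (M - ℓ.natDegree), W (M - ℓ.natDegree - g.natDegree) := by
  classical
  symm
  refine Finset.sum_bij (fun g _ => ℓ * g) ?_ ?_ ?_ ?_
  · intro g hg
    simp only [monicsLT, Finset.mem_filter] at hg ⊢
    exact ⟨⟨(mul_mem_polysLT hmonic.ne_zero).2 hg.1, hmonic.mul hg.2⟩, dvd_mul_right _ _⟩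
  · intro g _ g' _ h
    exact mul_left_cancel₀ hmonic.ne_zero h
  · intro g hg
    simp only [monicsLT, Finset.mem_filter] at hg ⊢
    obtain ⟨⟨hg, hgm⟩, s, rfl⟩ := hg
    exact ⟨s, ⟨(mul_mem_polysLT hmonic.ne_zero).1 hg, hmonic.of_mul_monic_left hgm⟩, rfl⟩
  · intro g hg
    simp only [monicsLT, Finset.mem_filter] at hg
    rw [hmonic.natDegree_mul hg.2, Nat.sub_sub]

open Classical in
lemma card_filter_natDegree_monicsLT {j M : ℕ} (hj : j < M) :
    {g ∈ monicsLT F M | g.natDegree = j}.card = Fintype.card F ^ j := by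
  rw [← card_polysLT]
  symm
  have key : ∀ p ∈ polysLT F j, (X ^ j + p).Monic ∧ (X ^ j + p).natDegree = j := by
    intro p hp
    rw [mem_polysLT] at hp
    refine ⟨monic_X_pow_add hp, ?_⟩
    rw [natDegree_add_eq_left_of_degree_lt (by rwa [degree_X_pow]), natDegree_X_pow]
  refine Finset.card_bij (fun p _ => X ^ j + p) ?_ ?_ ?_
  · intro p hp
    simp only [monicsLT, Finset.mem_filter, mem_polysLT]
    refine ⟨⟨?_, (key p hp).1⟩, (key p hp).2⟩
    rw [degree_eq_natDegree (key p hp).1.ne_zero, (key p hp).2]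
    exact_mod_cast hj
  · intro p _ p' _ h
    exact add_left_cancel h
  · intro g hg
    simp only [monicsLT, Finset.mem_filter] at hg
    refine ⟨g - X ^ j, ?_, by ring⟩
    rw [mem_polysLT, ← degree_X_pow (R := F) j]
    refine degree_sub_lt_right ?_ (monic_X_pow j).ne_zero ?_
    · rw [degree_X_pow, degree_eq_natDegree hg.1.2.ne_zero, hg.2]
    · rw [hg.1.2.leadingCoeff, (monic_X_pow j).leadingCoeff]

lemma sum_monicsLT (h : ℕ → ℝ) (M : ℕ) :
    ∑ g ∈ monicsLT F M, h g.natDegree = ∑ j ∈ Finset.range M, (Fintype.card F : ℝ) ^ j * h j := by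
  classical
  have hmaps : ∀ g ∈ monicsLT F M, g.natDegree ∈ Finset.range M := by
    intro g hg
    simp only [monicsLT, Finset.mem_filter, mem_polysLT] at hg
    rw [Finset.mem_range]
    rw [degree_eq_natDegree hg.2.ne_zero] at hg
    exact_mod_cast hg.1
  rw [← Finset.sum_fiberwise_of_maps_to hmaps]
  refine Finset.sum_congr rfl fun j hj => ?_
  rw [Finset.sum_congr rfl fun g hg => by rw [(Finset.mem_filter.1 hg).2], Finset.sum_const,
    card_filter_natDegree_monicsLT (Finset.mem_range.1 hj), nsmul_eq_mul, Nat.cast_pow]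

lemma tendsto_of_recurrence {m : ℕ} (hm : 0 < m) {c : ℝ} (hc0 : 0 ≤ c) (hc1 : c < 1)
    {x y : ℕ → ℝ} (h : ∀ N, x (N + m) = c * x N + y N) {L : ℝ} (hy : Tendsto y atTop (nhds L)) :
    Tendsto x atTop (nhds (L / (1 - c))) := by
  have hc : 0 < 1 - c := by linarith
  rw [Metric.tendsto_atTop] at hy ⊢
  intro ε hε
  obtain ⟨N₀, hN₀⟩ := hy (ε / 2 * (1 - c)) (by positivity)
  set z : ℕ → ℝ := fun N => |x N - L / (1 - c)| with hz
  have hstep : ∀ N ≥ N₀, z (N + m) ≤ c * z N + ε / 2 * (1 - c) := by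
    intro N hN
    have h1 : x (N + m) - L / (1 - c) = c * (x N - L / (1 - c)) + (y N - L) := by
      rw [h]; field_simp; ring
    have h2 := (hN₀ N hN).le
    rw [Real.dist_eq] at h2
    calc z (N + m) ≤ |c * (x N - L / (1 - c))| + |y N - L| := by
          simp only [hz, h1]; exact abs_add_le _ _
      _ ≤ _ := by rw [abs_mul, abs_of_nonneg hc0]; gcongr
  set B := ∑ r ∈ Finset.range m, z (N₀ + r) with hB
  have hB0 : 0 ≤ B := Finset.sum_nonneg fun _ _ => abs_nonneg _
  have hiter : ∀ k r, r < m → z (N₀ + r + k * m) ≤ c ^ k * B + ε / 2 := by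
    intro k r hr
    induction k with
    | zero =>
      have := Finset.single_le_sum (f := fun r => z (N₀ + r)) (fun _ _ => abs_nonneg _)
        (Finset.mem_range.2 hr)
      simp only [zero_mul, add_zero, pow_zero, one_mul]
      linarith
    | succ k ih =>
      have := hstep (N₀ + r + k * m) (by omega)
      rw [show N₀ + r + (k + 1) * m = N₀ + r + k * m + m by ring]
      calc _ ≤ _ := this
        _ ≤ c * (c ^ k * B + ε / 2) + ε / 2 * (1 - c) := by gcongr
        _ = _ := by ring
  have hlim : Tendsto (fun k => c ^ k * B) atTop (nhds 0) := by
    simpa using (tendsto_pow_atTop_nhds_zero_of_lt_one hc0 hc1).mul_const B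
  obtain ⟨K, hK⟩ := ((tendsto_order.1 hlim).2 (ε / 2) (by positivity)).exists_forall_of_atTop
  refine ⟨N₀ + K * m, fun N hN => ?_⟩
  have hdiv := Nat.div_add_mod (N - N₀) m
  have hk : K ≤ (N - N₀) / m := (Nat.le_div_iff_mul_le hm).2 (by omega)
  have := hiter ((N - N₀) / m) ((N - N₀) % m) (Nat.mod_lt _ hm)
  rw [show N₀ + (N - N₀) % m + (N - N₀) / m * m = N by rw [mul_comm ((N - N₀) / m)]; omega] at this
  rw [Real.dist_eq]
  exact this.trans_lt (by linarith [hK _ hk])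

/-- The passage from averages over `ℓ`-primitive pairs to averages over coprime pairs. -/
lemma tendsto_sum_coprimePairs {ℓ : F[X]} (hmonic : ℓ.Monic) (hℓ : 0 < ℓ.natDegree)
    (w : F[X] × F[X] → ℝ)
    (hw : ∀ g a b : F[X], g.Monic → ¬ ℓ ∣ g → w (g * a, g * b) = w (a, b)) {L : ℝ}
    (hL : Tendsto (fun M => (∑ p ∈ primitivePairs ℓ M, w p) / ((Fintype.card F : ℝ) ^ M) ^ 2)
      atTop (nhds L)) :
    Tendsto (fun M => (∑ p ∈ coprimePairs F M, w p) / ((Fintype.card F : ℝ) ^ M) ^ 2) atTop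
      (nhds (L / (1 - (((Fintype.card F : ℝ) ^ ℓ.natDegree) ^ 2)⁻¹) *
        (1 - (Fintype.card F : ℝ)⁻¹))) := by
  classical
  set q : ℝ := (Fintype.card F : ℝ) with hq
  have hq1 : 1 < q := by rw [hq]; exact_mod_cast Fintype.one_lt_card
  have hq0 : 0 < q := by linarith
  set m := ℓ.natDegree with hm
  obtain ⟨W, hW⟩ : ∃ W : ℕ → ℝ, ∀ M, W M = ∑ p ∈ coprimePairs F M, w p := ⟨_, fun _ => rfl⟩
  obtain ⟨U, hU⟩ : ∃ U : ℕ → ℝ, ∀ M, U M = ∑ g ∈ monicsLT F M, W (M - g.natDegree) :=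
    ⟨_, fun _ => rfl⟩
  simp only [← hW]
  have hV : ∀ M, ∑ p ∈ primitivePairs ℓ M, w p = U M - U (M - m) := by
    intro M
    rw [sum_primitivePairs w hw, eq_sub_iff_add_eq', hU, hU, hm, ← sum_monicsLT_dvd hmonic]
    simp only [← hW]
    exact Finset.sum_filter_add_sum_filter_not _ _ _
  have hUW : ∀ M, U (M + 1) = W (M + 1) + q * U M := by
    intro M
    have h1 := sum_monicsLT (F := F) (fun j => W (M + 1 - j)) (M + 1)
    have h2 := sum_monicsLT (F := F) (fun j => W (M - j)) M
    rw [hU, hU, h1, h2, Finset.sum_range_succ', Finset.mul_sum, pow_zero, one_mul, Nat.sub_zero, add_comm]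
    congr 1
    refine Finset.sum_congr rfl fun j _ => ?_
    rw [Nat.add_sub_add_right, pow_succ]
    ring
  have hUlim : Tendsto (fun M => U M / (q ^ M) ^ 2) atTop
      (nhds (L / (1 - ((q ^ m) ^ 2)⁻¹))) := by
    refine tendsto_of_recurrence (y := fun M => (∑ p ∈ primitivePairs ℓ (M + m), w p) /
      (q ^ (M + m)) ^ 2) hℓ (by positivity) ?_ ?_ ((tendsto_add_atTop_iff_nat m).2 hL)
    · exact inv_lt_one_of_one_lt₀ (one_lt_pow₀ (one_lt_pow₀ hq1 hℓ.ne') two_ne_zero)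
    · intro M
      rw [hV, Nat.add_sub_cancel, pow_add]
      field_simp
      ring
  rw [← tendsto_add_atTop_iff_nat 1]
  have h1 := ((tendsto_add_atTop_iff_nat 1).2 hUlim).sub (hUlim.const_mul q⁻¹)
  convert h1 using 2 with M
  · rw [hUW, pow_succ]
    field_simp
    ring
  · ring

omit [Fintype F] in
open Classical in
/-- Summing valuations by layers. -/
lemma sum_multiplicity_eq_tsum {ι : Type*} {ℓ : F[X]} (hirr : Irreducible ℓ) (s : Finset ι)
    (x : ι → F[X]) (hx : ∀ i ∈ s, x i ≠ 0) :
    ∑ i ∈ s, (multiplicity ℓ (x i) : ℝ) = ∑' k : ℕ, ({i ∈ s | ℓ ^ (k + 1) ∣ x i}.card : ℝ) := by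
  have h : ∀ i ∈ s, HasSum (fun k : ℕ => if ℓ ^ (k + 1) ∣ x i then (1 : ℝ) else 0)
      (multiplicity ℓ (x i)) := by
    intro i hi
    have hfin := FiniteMultiplicity.of_not_isUnit hirr.not_isUnit (hx i hi)
    have := hasSum_sum_of_ne_finset_zero (L := .unconditional ℕ) (s := Finset.range (multiplicity ℓ (x i)))
      (f := fun k : ℕ => if ℓ ^ (k + 1) ∣ x i then (1 : ℝ) else 0) fun k hk => by
        rw [Finset.mem_range] at hk
        rw [if_neg]
        rw [hfin.pow_dvd_iff_le_multiplicity]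
        omega
    rwa [Finset.sum_congr rfl fun k hk => if_pos (hfin.pow_dvd_iff_le_multiplicity.2
      (Finset.mem_range.1 hk)), Finset.sum_const, Finset.card_range, nsmul_eq_mul, mul_one] at this
  rw [← (hasSum_sum h).tsum_eq]
  simp only [Finset.sum_boole]

lemma tsum_inv_pow_succ {Q : ℝ} (hQ : 1 < Q) : ∑' k : ℕ, (Q ^ (k + 1))⁻¹ = 1 / (Q - 1) := by
  have h0 : 0 < Q := by linarith
  have h1 : Q - 1 ≠ 0 := by linarith
  simp_rw [← inv_pow, pow_succ]
  rw [tsum_mul_right, tsum_geometric_of_lt_one (by positivity) (inv_lt_one_of_one_lt₀ hQ)]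
  field_simp

lemma tendsto_inv_pow_atTop {q : ℝ} (hq : 1 < q) :
    Tendsto (fun M : ℕ => (q ^ M)⁻¹) atTop (nhds 0) :=
  (tendsto_pow_atTop_atTop_of_one_lt hq).inv_tendsto_atTop

/-- Summation over the levels `k` of the normalized counts `c k M`, corrected by the number `Z M`
of objects that are counted at every level. -/
lemma tendsto_tsum_counts {q : ℝ} (hq : 1 < q) {m d D : ℕ} (hm : 0 < m) (hd : 0 < d) {n : ℝ}
    (hn : 0 ≤ n) (c : ℕ → ℕ → ℝ) (Z : ℕ → ℝ) (hZ : ∀ M, 0 ≤ Z M) (hZc : ∀ k M, Z M ≤ c k M)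
    (hc : ∀ k M, 1 ≤ k → k * m ≤ M → c k M = n * (q ^ M - q ^ (M - m)) * q ^ (M - k * m))
    (hmono : ∀ j k M, j ≤ k → c k M ≤ c j M) (hvanish : ∀ k M, D + d * M < k → c k M = Z M) :
    Tendsto (fun M => Z M / (q ^ M) ^ 2) atTop (nhds 0) ∧
    Tendsto (fun M => (∑' k : ℕ, (c (k + 1) M - Z M)) / (q ^ M) ^ 2) atTop
      (nhds (n * (1 - (q ^ m)⁻¹) * (1 / (q ^ m - 1)))) := by
  have hq0 : 0 < q := by linarith
  have hsmall : ∀ k M, 1 ≤ k → k * m ≤ M → c k M ≤ n * q ^ M * q ^ (M - k * m) := by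
    intro k M hk hkM
    rw [hc k M hk hkM]
    gcongr
    linarith [pow_pos hq0 (M - m)]
  have hlarge : ∀ k M, m ≤ M → M < k * m → c k M ≤ n * q ^ M * q ^ m := by
    intro k M hM hk
    have h1 : 1 ≤ M / m := (Nat.le_div_iff_mul_le hm).2 (by omega)
    have h2 : M / m ≤ k := Nat.le_of_lt ((Nat.div_lt_iff_lt_mul hm).2 hk)
    refine (hmono _ _ M h2).trans ((hsmall _ M h1 (Nat.div_mul_le_self M m)).trans ?_)
    have h3 : M - M / m * m ≤ m := by
      have := Nat.mod_lt M hm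
      have := Nat.div_add_mod M m
      rw [mul_comm] at this
      omega
    exact mul_le_mul_of_nonneg_left (pow_le_pow_right₀ hq.le h3) (by positivity)
  have hZlim : Tendsto (fun M => Z M / (q ^ M) ^ 2) atTop (nhds 0) := by
    have hlim : Tendsto (fun M : ℕ => n * q ^ m * (q ^ M)⁻¹) atTop (nhds 0) := by
      simpa using (tendsto_inv_pow_atTop hq).const_mul (n * q ^ m)
    refine squeeze_zero' (Eventually.of_forall fun M => div_nonneg (hZ M) (by positivity)) ?_ hlim
    filter_upwards [eventually_ge_atTop m] with M hM
    have hMm : M < (M + 1) * m := by nlinarith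
    have := (hZc (M + 1) M).trans (hlarge _ M hM hMm)
    rw [div_le_iff₀ (by positivity)]
    calc Z M ≤ _ := this
      _ = _ := by field_simp
  refine ⟨hZlim, ?_⟩
  obtain ⟨r, hr0, hrd⟩ : ∃ r : ℝ, 0 < r ∧ r ^ d = q⁻¹ := by
    refine ⟨(q⁻¹) ^ ((d : ℝ)⁻¹), Real.rpow_pos_of_pos (by positivity) _, ?_⟩
    exact Real.rpow_inv_natCast_pow (by positivity) hd.ne'
  have hr1 : r < 1 := by
    by_contra! h
    have := one_le_pow₀ h (n := d)
    rw [hrd] at this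
    exact absurd (inv_lt_one_of_one_lt₀ hq) (by linarith)
  have hqr : q⁻¹ ≤ r := by
    rw [← hrd]
    exact pow_le_of_le_one hr0.le hr1.le hd.ne'
  have hrD : r ^ D ≤ 1 := pow_le_one₀ hr0.le hr1.le
  have hbound : ∀ M, m ≤ M → ∀ k, ‖(c (k + 1) M - Z M) / (q ^ M) ^ 2‖ ≤
      n * q ^ m / r ^ D * r ^ (k + 1) := by
    intro M hM k
    rw [Real.norm_of_nonneg (div_nonneg (sub_nonneg.2 (hZc _ _)) (by positivity)),
      div_le_iff₀ (by positivity)]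
    rcases le_or_gt ((k + 1) * m) M with hkM | hkM
    · have h1 := hsmall (k + 1) M (by omega) hkM
      have h2 : q ^ M = q ^ (M - (k + 1) * m) * q ^ ((k + 1) * m) := by
        rw [← pow_add, Nat.sub_add_cancel hkM]
      have h3 : 1 ≤ r ^ (k + 1) * q ^ ((k + 1) * m) := by
        rw [mul_comm (k + 1) m, pow_mul, ← mul_pow]
        refine one_le_pow₀ ?_
        calc (1 : ℝ) = q⁻¹ * q := by field_simp
          _ ≤ r * q ^ m := mul_le_mul hqr (le_self_pow₀ hq.le hm.ne') hq0.le hr0.le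
      have h4 : 1 ≤ q ^ m / r ^ D := by
        rw [one_le_div (by positivity)]
        exact hrD.trans (one_le_pow₀ hq.le)
      calc c (k + 1) M - Z M ≤ n * q ^ M * q ^ (M - (k + 1) * m) * (1 * 1) := by
            rw [mul_one, mul_one]; linarith [hZ M]
        _ ≤ n * q ^ M * q ^ (M - (k + 1) * m) *
            ((r ^ (k + 1) * q ^ ((k + 1) * m)) * (q ^ m / r ^ D)) := by gcongr
        _ = n * q ^ M * (q ^ (M - (k + 1) * m) * q ^ ((k + 1) * m)) * r ^ (k + 1) *
            (q ^ m / r ^ D) := by ring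
        _ = _ := by rw [← h2]; ring
    · rcases le_or_gt (k + 1) (D + d * M) with hk | hk
      · have h1 := hlarge (k + 1) M hM hkM
        have h2 : r ^ D * (q ^ M)⁻¹ ≤ r ^ (k + 1) := by
          rw [← inv_pow, ← hrd, ← pow_mul, ← pow_add]
          exact pow_le_pow_of_le_one hr0.le hr1.le hk
        calc c (k + 1) M - Z M ≤ n * q ^ M * q ^ m := by linarith [hZ M]
          _ = n * q ^ m / r ^ D * (r ^ D * (q ^ M)⁻¹) * (q ^ M) ^ 2 := by field_simp
          _ ≤ _ := by gcongr
      · rw [hvanish _ _ hk, sub_self]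
        positivity
  have hpt : ∀ k : ℕ, Tendsto (fun M => (c (k + 1) M - Z M) / (q ^ M) ^ 2) atTop
      (nhds (n * (1 - (q ^ m)⁻¹) * ((q ^ m) ^ (k + 1))⁻¹)) := by
    intro k
    have h1 : Tendsto (fun M => n * (1 - (q ^ m)⁻¹) * ((q ^ m) ^ (k + 1))⁻¹ - Z M / (q ^ M) ^ 2)
        atTop (nhds (n * (1 - (q ^ m)⁻¹) * ((q ^ m) ^ (k + 1))⁻¹ - 0)) :=
      tendsto_const_nhds.sub hZlim
    rw [sub_zero] at h1
    refine h1.congr' ?_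
    filter_upwards [eventually_ge_atTop ((k + 1) * m)] with M hM
    have hM' : m ≤ M := le_trans (Nat.le_mul_of_pos_left m k.succ_pos) hM
    rw [sub_div, hc _ _ (by omega) hM, pow_sub₀ _ hq0.ne' hM, pow_sub₀ _ hq0.ne' hM',
      mul_comm (k + 1) m, pow_mul]
    field_simp
  have hmain := tendsto_tsum_of_dominated_convergence (𝓕 := atTop)
    (((summable_nat_add_iff 1).2 (summable_geometric_of_lt_one hr0.le hr1)).mul_left
      (n * q ^ m / r ^ D)) hpt (by
        filter_upwards [eventually_ge_atTop m] with M hM using hbound M hM)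
  rw [tsum_mul_left, tsum_inv_pow_succ (one_lt_pow₀ hq hm.ne')] at hmain
  simpa only [tsum_div_const] using hmain

lemma tendsto_average_multiplicity {ℓ : F[X]} (hmonic : ℓ.Monic) (hirr : Irreducible ℓ) :
    open Classical in
    Tendsto (fun M => (∑ P ∈ polysLT F M with P ≠ 0, (multiplicity ℓ P : ℝ)) /
      (({P ∈ polysLT F M | P ≠ 0}.card : ℕ) : ℝ)) atTop
      (nhds (1 / ((Fintype.card F : ℝ) ^ ℓ.natDegree - 1))) := by
  classical
  set q : ℝ := (Fintype.card F : ℝ) with hq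
  set m := ℓ.natDegree with hm
  have hm0 : 0 < m := hirr.natDegree_pos
  have hq1 : 1 < q := by rw [hq]; exact_mod_cast Fintype.one_lt_card
  have hq0 : 0 < q := by linarith
  have hzero : ∀ M, (0 : F[X]) ∈ polysLT F M := fun M => by
    rw [mem_polysLT, degree_zero]; exact WithBot.bot_lt_coe _
  have hcard : ∀ M, ({P ∈ polysLT F M | P ≠ 0}.card : ℝ) = q ^ M - 1 := by
    intro M
    rw [Finset.filter_ne', Finset.card_erase_of_mem (hzero M), card_polysLT,
      Nat.cast_sub (Nat.one_le_pow _ _ Fintype.card_pos), Nat.cast_pow, Nat.cast_one]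
  have hcnt : ∀ k M, ({P ∈ {P ∈ polysLT F M | P ≠ 0} | ℓ ^ (k + 1) ∣ P}.card : ℝ) =
      q ^ (M - (k + 1) * m) - 1 := by
    intro k M
    have hmem : (0 : F[X]) ∈ {P ∈ polysLT F M | ℓ ^ (k + 1) ∣ P} := by simp [hzero M]
    rw [Finset.filter_filter, Finset.filter_congr fun P _ => and_comm, ← Finset.filter_filter,
      Finset.filter_ne', Finset.card_erase_of_mem hmem, card_filter_dvd (hmonic.pow _),
      Nat.cast_sub (Nat.one_le_pow _ _ Fintype.card_pos), Nat.cast_pow, Nat.cast_one,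
      hmonic.natDegree_pow]
  have hden : Tendsto (fun M : ℕ => 1 - (q ^ M)⁻¹) atTop (nhds 1) := by
    simpa using (tendsto_inv_pow_atTop hq1).const_sub 1
  have hnum : Tendsto (fun M => ∑' k : ℕ, (q ^ (M - (k + 1) * m) - 1) / q ^ M) atTop
      (nhds (∑' k : ℕ, ((q ^ m) ^ (k + 1))⁻¹)) := by
    refine tendsto_tsum_of_dominated_convergence (bound := fun k : ℕ => ((q ^ m) ^ (k + 1))⁻¹)
      ?_ ?_ (Eventually.of_forall fun M k => ?_)
    · simp_rw [← inv_pow (q ^ m)]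
      exact (summable_nat_add_iff 1).2 (summable_geometric_of_lt_one (by positivity)
        (inv_lt_one_of_one_lt₀ (one_lt_pow₀ hq1 hm0.ne')))
    · intro k
      have := (tendsto_inv_pow_atTop hq1).const_sub (((q ^ m) ^ (k + 1))⁻¹)
      rw [sub_zero] at this
      refine this.congr' ?_
      filter_upwards [eventually_ge_atTop ((k + 1) * m)] with M hM
      rw [pow_sub₀ _ hq0.ne' hM, mul_comm (k + 1) m, pow_mul]
      field_simp
    · have h1 : 1 ≤ q ^ (M - (k + 1) * m) := one_le_pow₀ hq1.le
      rw [Real.norm_of_nonneg (div_nonneg (by linarith) (by positivity)),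
        div_le_iff₀ (by positivity)]
      rcases le_or_gt ((k + 1) * m) M with hM | hM
      · rw [pow_sub₀ _ hq0.ne' hM, mul_comm (k + 1) m, pow_mul]
        linarith
      · rw [Nat.sub_eq_zero_of_le hM.le, pow_zero, sub_self]
        positivity
  rw [tsum_inv_pow_succ (one_lt_pow₀ hq1 hm0.ne')] at hnum
  have hdiv := hnum.div hden one_ne_zero
  rw [div_one] at hdiv
  refine hdiv.congr fun M => ?_
  rw [hcard, sum_multiplicity_eq_tsum hirr _ _ fun P hP => (Finset.mem_filter.1 hP).2,
    Pi.div_apply, tsum_div_const]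
  simp_rw [hcnt]
  rw [div_div]
  congr 1
  field_simp

omit [Fintype F] in
lemma exists_natDegree_homogEval_le (f : F[X][X]) : ∃ D, ∀ (M : ℕ) (a b : F[X]),
    a.natDegree ≤ M → b.natDegree ≤ M → (homogEval f a b).natDegree ≤ D + f.natDegree * M := by
  refine ⟨(Finset.range (f.natDegree + 1)).sup fun i => (f.coeff i).natDegree,
    fun M a b ha hb => ?_⟩
  refine natDegree_sum_le_of_forall_le _ _ fun i hi => ?_
  have h1 := Finset.le_sup (f := fun i => (f.coeff i).natDegree) hi
  have h2 : i ≤ f.natDegree := by simpa [Nat.lt_succ_iff] using hi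
  calc _ ≤ (f.coeff i).natDegree + i * a.natDegree + (f.natDegree - i) * b.natDegree :=
        natDegree_mul_le_of_le (natDegree_mul_le_of_le le_rfl natDegree_pow_le) natDegree_pow_le
    _ ≤ (f.coeff i).natDegree + i * M + (f.natDegree - i) * M := by gcongr
    _ = (f.coeff i).natDegree + f.natDegree * M := by
        rw [add_assoc, ← add_mul, Nat.add_sub_cancel' h2]
    _ ≤ _ := by gcongr

omit [Fintype F] in
lemma degree_le_iff_degree_lt_succ {a : F[X]} {N : ℕ} :
    a.degree ≤ (N : WithBot ℕ) ↔ a.degree < ((N + 1 : ℕ) : WithBot ℕ) := by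
  rw [degree_le_iff_coeff_zero, degree_lt_iff_coeff_zero]
  simp only [Nat.cast_lt, Nat.succ_le_iff]

omit [Fintype F] in
/-- A root of multiplicity one modulo `ℓ` is not a root of the derivative modulo `ℓ`. -/
lemma not_dvd_derivative_eval {ℓ r : F[X]} {g : F[X][X]} (hr : ℓ ∣ g.eval r)
    (h : rootMultiplicity (Ideal.Quotient.mk (Ideal.span {ℓ}) r)
      (g.map (Ideal.Quotient.mk (Ideal.span {ℓ}))) = 1) : ¬ ℓ ∣ g.derivative.eval r := by
  intro hd
  have hne : g.map (Ideal.Quotient.mk (Ideal.span {ℓ})) ≠ 0 := by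
    intro h0
    rw [h0, rootMultiplicity_zero] at h
    exact zero_ne_one h
  refine h.not_gt ((one_lt_rootMultiplicity_iff_isRoot hne).2 ⟨?_, ?_⟩)
  · rw [IsRoot.def, eval_map, eval₂_hom, Ideal.Quotient.eq_zero_iff_dvd]
    exact hr
  · rw [derivative_map, IsRoot.def, eval_map, eval₂_hom, Ideal.Quotient.eq_zero_iff_dvd]
    exact hd

lemma tendsto_average_multiplicity_homogEval {ℓ : F[X]} (hmonic : ℓ.Monic)
    (hirr : Irreducible ℓ) (f : F[X][X]) (hf : 0 < f.natDegree) (S T : Finset F[X])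
    (hS : ∀ r, r ∈ S ↔ r.degree < ℓ.degree ∧ ℓ ∣ f.eval r)
    (hS' : ∀ r ∈ S, ¬ ℓ ∣ f.derivative.eval r)
    (hT : ∀ r, r ∈ T ↔ r.degree < ℓ.degree ∧ ℓ ∣ r ∧ ℓ ∣ homogEval f 1 r)
    (hT' : ∀ r ∈ T, ¬ ℓ ∣ (reflect f.natDegree f).derivative.eval r) :
    open Classical in
    Tendsto (fun M => (∑ p ∈ coprimePairs F M with homogEval f p.1 p.2 ≠ 0,
        (multiplicity ℓ (homogEval f p.1 p.2) : ℝ)) /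
      (({p ∈ coprimePairs F M | homogEval f p.1 p.2 ≠ 0}.card : ℕ) : ℝ)) atTop
      (nhds ((S.card + T.card) * (1 - ((Fintype.card F : ℝ) ^ ℓ.natDegree)⁻¹) *
        (1 / ((Fintype.card F : ℝ) ^ ℓ.natDegree - 1)) /
        (1 - (((Fintype.card F : ℝ) ^ ℓ.natDegree) ^ 2)⁻¹))) := by
  classical
  set q : ℝ := (Fintype.card F : ℝ) with hq
  set m := ℓ.natDegree with hm
  have hm0 : 0 < m := hirr.natDegree_pos
  have hq1 : 1 < q := by rw [hq]; exact_mod_cast Fintype.one_lt_card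
  have hq0 : 0 < q := by linarith
  obtain ⟨D, hD⟩ := exists_natDegree_homogEval_le f
  set Z : ℕ → Finset (F[X] × F[X]) := fun M => {p ∈ primitivePairs ℓ M | homogEval f p.1 p.2 = 0}
    with hZdef
  set c : ℕ → ℕ → Finset (F[X] × F[X]) := fun k M =>
    {p ∈ primitivePairs ℓ M | ℓ ^ k ∣ homogEval f p.1 p.2} with hcdef
  have hZc : ∀ k M, Z M ⊆ c k M := fun k M p hp => by
    simp only [hZdef, hcdef, Finset.mem_filter] at hp ⊢
    exact ⟨hp.1, hp.2 ▸ dvd_zero _⟩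
  have hdiff : ∀ k M, (((c k M).card : ℝ) - (Z M).card) =
      ({p ∈ {p ∈ primitivePairs ℓ M | homogEval f p.1 p.2 ≠ 0} |
        ℓ ^ k ∣ homogEval f p.1 p.2}.card : ℝ) := by
    intro k M
    rw [← Finset.cast_card_sdiff (hZc k M)]
    congr 2
    ext p
    simp only [hZdef, hcdef, Finset.mem_filter, Finset.mem_sdiff]
    tauto
  have hnatDegree : ∀ M (x : F[X]), x ∈ polysLT F M → x.natDegree ≤ M := fun M x hx =>
    natDegree_le_of_degree_le (mem_polysLT.1 hx).le
  obtain ⟨hZlim, hclim⟩ := tendsto_tsum_counts hq1 hm0 hf (D := D)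
    (n := (S.card : ℝ) + T.card) (by positivity) (fun k M => ((c k M).card : ℝ))
    (fun M => ((Z M).card : ℝ)) (fun M => by positivity)
    (fun k M => by exact_mod_cast Finset.card_le_card (hZc k M))
    (fun k M hk hkM => card_filter_primitivePairs hmonic hirr f S T hS hS' hT hT' hk hkM)
    (fun j k M hjk => by
      refine Nat.cast_le.2 (Finset.card_le_card fun p hp => ?_)
      simp only [hcdef, Finset.mem_filter] at hp ⊢
      exact ⟨hp.1, (pow_dvd_pow ℓ hjk).trans hp.2⟩)
    (fun k M hk => by
      rw [← sub_eq_zero, hdiff, Nat.cast_eq_zero, Finset.card_eq_zero]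
      refine Finset.filter_eq_empty_iff.2 fun p hp hdvd => ?_
      simp only [primitivePairs, Finset.mem_filter, Finset.mem_product] at hp
      have h1 := natDegree_le_of_dvd hdvd hp.2
      rw [hmonic.natDegree_pow] at h1
      have h2 := hD M p.1 p.2 (hnatDegree _ _ hp.1.1.1) (hnatDegree _ _ hp.1.1.2)
      have h3 : k ≤ k * ℓ.natDegree := Nat.le_mul_of_pos_right k hm0
      omega)
  have hscale : ∀ g a b : F[X], homogEval f (g * a) (g * b) =
      g ^ f.natDegree * homogEval f a b := homogEval_mul_mul f
  have hA := tendsto_sum_coprimePairs hmonic hm0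
    (fun p => if homogEval f p.1 p.2 ≠ 0 then (multiplicity ℓ (homogEval f p.1 p.2) : ℝ) else 0)
    (fun g a b hg hℓg => by
      have hg0 : g ^ f.natDegree ≠ 0 := pow_ne_zero _ hg.ne_zero
      have hiff : homogEval f (g * a) (g * b) ≠ 0 ↔ homogEval f a b ≠ 0 := by
        rw [hscale, mul_ne_zero_iff, and_iff_right hg0]
      by_cases h0 : homogEval f a b = 0
      · rw [if_neg (fun h => hiff.1 h h0), if_neg (fun h => h h0)]
      · have hfin := FiniteMultiplicity.of_not_isUnit hirr.not_isUnit (hiff.2 h0)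
        rw [hscale] at hfin
        rw [if_pos (hiff.2 h0), if_pos h0, hscale, multiplicity_mul hirr.prime hfin,
          multiplicity_eq_zero.2 fun h => hℓg (hirr.prime.dvd_of_dvd_pow h), zero_add])
    (L := (S.card + T.card) * (1 - (q ^ m)⁻¹) * (1 / (q ^ m - 1))) (by
    refine hclim.congr fun M => ?_
    rw [← Finset.sum_filter, sum_multiplicity_eq_tsum hirr _ _ fun p hp =>
      (Finset.mem_filter.1 hp).2]
    simp only [hdiff, hq])
  have hB := tendsto_sum_coprimePairs hmonic hm0
    (fun p => if homogEval f p.1 p.2 ≠ 0 then 1 else 0)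
    (fun g a b hg _ => by
      have hg0 : g ^ f.natDegree ≠ 0 := pow_ne_zero _ hg.ne_zero
      simp only [hscale, mul_ne_zero_iff, and_iff_right hg0]) (L := 1 - ((q ^ m) ^ 2)⁻¹) (by
    have h1 := hZlim.const_sub (1 - ((q ^ m) ^ 2)⁻¹)
    rw [sub_zero] at h1
    refine h1.congr' ?_
    filter_upwards [eventually_ge_atTop m] with M hM
    have h2 := Finset.card_filter_add_card_filter_not (s := primitivePairs ℓ M)
      (fun p => homogEval f p.1 p.2 = 0)
    have h3 : (({p ∈ primitivePairs ℓ M | homogEval f p.1 p.2 ≠ 0}.card : ℕ) : ℝ) =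
        (q ^ M) ^ 2 - (q ^ (M - m)) ^ 2 - (Z M).card := by
      rw [← card_primitivePairs hmonic, ← h2, Nat.cast_add, add_sub_cancel_left]
    rw [← hq, Finset.sum_boole, h3, pow_sub₀ _ hq0.ne' hM]
    field_simp)
  rw [← hq, ← hm] at hA hB
  have hm2 : 1 - ((q ^ m) ^ 2)⁻¹ ≠ 0 := by
    have := inv_lt_one_of_one_lt₀ (one_lt_pow₀ (one_lt_pow₀ hq1 hm0.ne') two_ne_zero)
    linarith
  have hκ : 1 - q⁻¹ ≠ 0 := by
    have := inv_lt_one_of_one_lt₀ hq1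
    linarith
  have hdiv := hA.div hB (mul_ne_zero (div_ne_zero hm2 hm2) hκ)
  rw [div_self hm2, one_mul, mul_div_cancel_right₀ _ hκ] at hdiv
  refine hdiv.congr fun M => ?_
  have hne : (q ^ M) ^ 2 ≠ 0 := by positivity
  rw [Pi.div_apply, div_div_div_cancel_right₀ hne, Finset.sum_boole, ← Finset.sum_filter]

end AlphaEll

/-- (Corollary `cor_ell`.)  If all affine and projective roots of `f`
modulo `ℓ` are simple (simple roots of the reduction mod `ℓ` of `f`, resp. of its reverse
`reflect d f`, i.e. of `Y ↦ F(1,Y)`), and `n_ℓ` is their total number, then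
`α_ℓ(f) = (deg ℓ/(Norm(ℓ)-1)) (1 - Norm(ℓ)/(Norm(ℓ)+1) · n_ℓ)`. -/
theorem alpha_ell_simple_roots
    (Fq : Type*) [Field Fq] [Fintype Fq]
    (f : Polynomial (Polynomial Fq)) (d : ℕ) (hd : f.natDegree = d) (hd1 : 1 ≤ d)
    (hsep : (f.map (algebraMap (Polynomial Fq) (RatFunc Fq))).Separable)
    (ℓ : Polynomial Fq) (hmonic : ℓ.Monic) (hirr : Irreducible ℓ)
    (hcont : ∃ i, ¬ ℓ ∣ f.coeff i)
    (hsimple : ∀ r : Polynomial Fq, r.degree < ℓ.degree →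
      (ℓ ∣ f.eval r →
        rootMultiplicity ((Ideal.Quotient.mk (Ideal.span {ℓ})) r)
          (f.map (Ideal.Quotient.mk (Ideal.span {ℓ}))) = 1) ∧
      (ℓ ∣ r → ℓ ∣ homogEval f 1 r →
        rootMultiplicity ((Ideal.Quotient.mk (Ideal.span {ℓ})) r)
          ((Polynomial.reflect d f).map (Ideal.Quotient.mk (Ideal.span {ℓ}))) = 1)) :
    ∃ A₁ A₂ : ℝ,
      Filter.Tendsto (fun N : ℕ =>
          (∑ᶠ P ∈ {P : Polynomial Fq | P ≠ 0 ∧ P.degree ≤ (N : WithBot ℕ)},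
            (multiplicity ℓ P : ℝ)) /
          (({P : Polynomial Fq | P ≠ 0 ∧ P.degree ≤ (N : WithBot ℕ)}).ncard : ℝ))
        Filter.atTop (nhds A₁) ∧
      Filter.Tendsto (fun N : ℕ =>
          (∑ᶠ ab ∈ {ab : Polynomial Fq × Polynomial Fq | IsCoprime ab.1 ab.2 ∧
              homogEval f ab.1 ab.2 ≠ 0 ∧
              ab.1.degree ≤ (N : WithBot ℕ) ∧ ab.2.degree ≤ (N : WithBot ℕ)},
            (multiplicity ℓ (homogEval f ab.1 ab.2) : ℝ)) /
          (({ab : Polynomial Fq × Polynomial Fq | IsCoprime ab.1 ab.2 ∧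
              homogEval f ab.1 ab.2 ≠ 0 ∧
              ab.1.degree ≤ (N : WithBot ℕ) ∧ ab.2.degree ≤ (N : WithBot ℕ)}).ncard : ℝ))
        Filter.atTop (nhds A₂) ∧
      (ℓ.natDegree : ℝ) * (A₁ - A₂) =
        ((ℓ.natDegree : ℝ) / ((Fintype.card Fq : ℝ) ^ ℓ.natDegree - 1)) *
          (1 - ((Fintype.card Fq : ℝ) ^ ℓ.natDegree / ((Fintype.card Fq : ℝ) ^ ℓ.natDegree + 1)) *
            ((({r : Polynomial Fq | r.degree < ℓ.degree ∧ ℓ ∣ f.eval r}).ncard : ℝ) +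
             (({r : Polynomial Fq | r.degree < ℓ.degree ∧ ℓ ∣ r ∧
                 ℓ ∣ homogEval f 1 r}).ncard : ℝ))) := by
  classical
  subst hd
  set m := ℓ.natDegree with hm
  have hdeg : ℓ.degree = (m : WithBot ℕ) := degree_eq_natDegree hirr.ne_zero
  set S : Finset Fq[X] := {r ∈ polysLT Fq m | ℓ ∣ f.eval r} with hSdef
  set T : Finset Fq[X] := {r ∈ polysLT Fq m | ℓ ∣ r ∧ ℓ ∣ homogEval f 1 r} with hTdef
  have hS : ∀ r, r ∈ S ↔ r.degree < ℓ.degree ∧ ℓ ∣ f.eval r := fun r => by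
    rw [hSdef, Finset.mem_filter, mem_polysLT, hdeg]
  have hT : ∀ r, r ∈ T ↔ r.degree < ℓ.degree ∧ ℓ ∣ r ∧ ℓ ∣ homogEval f 1 r := fun r => by
    rw [hTdef, Finset.mem_filter, mem_polysLT, hdeg]
  have hSset : {r : Fq[X] | r.degree < ℓ.degree ∧ ℓ ∣ f.eval r} = S :=
    Set.ext fun r => (hS r).symm
  have hTset : {r : Fq[X] | r.degree < ℓ.degree ∧ ℓ ∣ r ∧ ℓ ∣ homogEval f 1 r} = T :=
    Set.ext fun r => (hT r).symm
  have hS' : ∀ r ∈ S, ¬ ℓ ∣ f.derivative.eval r := fun r hr => by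
    have hr := (hS r).1 hr
    exact not_dvd_derivative_eval hr.2 ((hsimple r hr.1).1 hr.2)
  have hT' : ∀ r ∈ T, ¬ ℓ ∣ (reflect f.natDegree f).derivative.eval r := fun r hr => by
    have hr := (hT r).1 hr
    exact not_dvd_derivative_eval (homogEval_one_left f r ▸ hr.2.2)
      ((hsimple r hr.1).2 hr.2.1 hr.2.2)
  have hpoly : ∀ N : ℕ, {P : Fq[X] | P ≠ 0 ∧ P.degree ≤ (N : WithBot ℕ)} =
      ({P ∈ polysLT Fq (N + 1) | P ≠ 0} : Finset Fq[X]) := fun N => by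
    ext P
    simp only [Set.mem_ofPred_eq, Finset.coe_filter, mem_polysLT, degree_le_iff_degree_lt_succ]
    exact and_comm
  have hpair : ∀ N : ℕ, {ab : Fq[X] × Fq[X] | IsCoprime ab.1 ab.2 ∧ homogEval f ab.1 ab.2 ≠ 0 ∧
      ab.1.degree ≤ (N : WithBot ℕ) ∧ ab.2.degree ≤ (N : WithBot ℕ)} =
      ({p ∈ coprimePairs Fq (N + 1) | homogEval f p.1 p.2 ≠ 0} : Finset (Fq[X] × Fq[X])) :=
    fun N => by
      ext p
      simp only [coprimePairs, Set.mem_ofPred_eq, Finset.coe_filter, Finset.mem_filter,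
        Finset.mem_product, mem_polysLT, degree_le_iff_degree_lt_succ]
      tauto
  refine ⟨1 / ((Fintype.card Fq : ℝ) ^ m - 1),
    (S.card + T.card) * (1 - ((Fintype.card Fq : ℝ) ^ m)⁻¹) *
      (1 / ((Fintype.card Fq : ℝ) ^ m - 1)) / (1 - (((Fintype.card Fq : ℝ) ^ m) ^ 2)⁻¹),
    ?_, ?_, ?_⟩
  · simp only [hpoly, finsum_mem_coe_finset, Set.ncard_coe_finset]
    exact (tendsto_add_atTop_iff_nat 1).2 (tendsto_average_multiplicity hmonic hirr)
  · simp only [hpair, finsum_mem_coe_finset, Set.ncard_coe_finset]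
    exact (tendsto_add_atTop_iff_nat 1).2
      (tendsto_average_multiplicity_homogEval hmonic hirr f hd1 S T hS hS' hT hT')
  · rw [hSset, hTset, Set.ncard_coe_finset, Set.ncard_coe_finset]
    have hQ : 1 < (Fintype.card Fq : ℝ) ^ m :=
      one_lt_pow₀ (by exact_mod_cast Fintype.one_lt_card) hirr.natDegree_pos.ne'
    set Q := (Fintype.card Fq : ℝ) ^ m
    have h1 : Q - 1 ≠ 0 := by linarith
    have h2 : Q + 1 ≠ 0 := by linarith
    have h3 : Q ≠ 0 := by linarith
    have h4 : 1 - (Q ^ 2)⁻¹ = (Q - 1) * (Q + 1) / Q ^ 2 := by field_simp; ring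
    rw [h4]
    field_simp
end

section
/- Let q be a prime power and g = g_1 x + g_0 ∈ F_q[t][x] with g_1 ≠ 0 and gcd(g_0, g_1) = 1. Then α(g) := lim_{b_0 → ∞} Σ_{ℓ monic irreducible, deg ℓ ≤ b_0} α_ℓ(g) exists and equals 1/(q − 1). -/
open Polynomial Filter

section Average

open scoped Classical

variable {F : Type*} [Field F]

theorem finiteMultiplicity_of_irreducible {ℓ x : F[X]} (hi : Irreducible ℓ) (hx : x ≠ 0) :
    FiniteMultiplicity ℓ x :=
  FiniteMultiplicity.of_not_isUnit hi.not_isUnit hx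

theorem multiplicity_mul_natDegree_le {ℓ x : F[X]} (hx : x ≠ 0) :
    multiplicity ℓ x * ℓ.natDegree ≤ x.natDegree := by
  rw [← natDegree_pow]
  exact natDegree_le_of_dvd (pow_multiplicity_dvd ℓ x) hx

theorem multiplicity_eq_sum {ℓ x : F[X]} (hi : Irreducible ℓ) (hx : x ≠ 0) {n : ℕ}
    (hn : x.natDegree ≤ n) :
    (multiplicity ℓ x : ℝ) = ∑ k ∈ Finset.range n, if ℓ ^ (k + 1) ∣ x then 1 else 0 := by
  have hle : multiplicity ℓ x ≤ n :=
    (Nat.le_mul_of_pos_right _ hi.natDegree_pos).trans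
      ((multiplicity_mul_natDegree_le hx).trans hn)
  rw [Finset.sum_boole]
  congr 1
  rw [← Finset.card_range (multiplicity ℓ x)]
  congr 1
  ext k
  rw [Finset.mem_filter, Finset.mem_range, Finset.mem_range,
    (finiteMultiplicity_of_irreducible hi hx).pow_dvd_iff_le_multiplicity]
  omega

variable [Fintype F] {ι : Type*} {V : ℕ → Finset ι} {f : ι → F[X]} {ℓ : F[X]}

theorem card_div_le (hne : ∀ N, (V N).Nonempty)
    (hcount : ∀ N k, k * ℓ.natDegree ≤ N + 1 →
      ((V N).filter fun v => ℓ ^ k ∣ f v).card * Fintype.card F ^ (k * ℓ.natDegree) = (V N).card)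
    {N K e : ℕ} (h : K ≤ e + (N + 1) / ℓ.natDegree * ℓ.natDegree)
    (k : ℕ) (hk : K ≤ e + k * ℓ.natDegree) {s : Finset ι} (hs : s ⊆ V N)
    (hdvd : ∀ v ∈ s, ℓ ^ k ∣ f v) :
    (s.card : ℝ) / (V N).card ≤ (Fintype.card F : ℝ) ^ e * (1 / (Fintype.card F : ℝ)) ^ K := by
  set d := ℓ.natDegree
  set j := min k ((N + 1) / d) with hj
  have hjd : j * d ≤ N + 1 :=
    (Nat.mul_le_mul_right _ (min_le_right _ _)).trans (Nat.div_mul_le_self _ _)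
  have hK : K ≤ e + j * d := by
    rcases min_choice k ((N + 1) / d) with h' | h' <;> rw [hj, h'] <;> assumption
  have hq1 : (1 : ℝ) ≤ Fintype.card F := by exact_mod_cast Fintype.card_pos
  have hq : (0 : ℝ) < Fintype.card F := by linarith
  have hV : (0 : ℝ) < (V N).card := by exact_mod_cast (hne N).card_pos
  have hle : (s.card : ℝ) ≤ ((V N).filter fun v => ℓ ^ j ∣ f v).card := by
    refine Nat.cast_le.2 (Finset.card_le_card fun v hv => Finset.mem_filter.2 ⟨hs hv, ?_⟩)
    exact (pow_dvd_pow ℓ (min_le_left _ _)).trans (hdvd v hv)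
  have hc : (((V N).filter fun v => ℓ ^ j ∣ f v).card : ℝ) * (Fintype.card F : ℝ) ^ (j * d)
      = (V N).card := by exact_mod_cast hcount N j hjd
  have hpow : (Fintype.card F : ℝ) ^ K ≤ (Fintype.card F : ℝ) ^ (e + j * d) :=
    pow_le_pow_right₀ hq1 hK
  rw [one_div, inv_pow, ← div_eq_mul_inv, div_le_div_iff₀ hV (by positivity), ← hc]
  calc (s.card : ℝ) * (Fintype.card F : ℝ) ^ K
      ≤ ((V N).filter fun v => ℓ ^ j ∣ f v).card * (Fintype.card F : ℝ) ^ (e + j * d) := by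
        gcongr
    _ = _ := by rw [pow_add]; ring

theorem le_add_div_mul {d : ℕ} (hd : 0 < d) (n : ℕ) : n ≤ d + n / d * d :=
  (Nat.lt_div_mul_add hd).le.trans (by omega)

theorem tendsto_card_filter_eq_zero_div (hne : ∀ N, (V N).Nonempty) (hi : Irreducible ℓ)
    (hcount : ∀ N k, k * ℓ.natDegree ≤ N + 1 →
      ((V N).filter fun v => ℓ ^ k ∣ f v).card * Fintype.card F ^ (k * ℓ.natDegree)
        = (V N).card) :
    Tendsto (fun N => (((V N).filter fun v => f v = 0).card : ℝ) / (V N).card) atTop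
      (nhds 0) := by
  have hq1 : (1 : ℝ) < Fintype.card F := by exact_mod_cast Fintype.one_lt_card
  have hlim : Tendsto (fun N : ℕ => (Fintype.card F : ℝ) ^ ℓ.natDegree *
      (1 / (Fintype.card F : ℝ)) ^ N) atTop (nhds 0) := by
    have := (tendsto_pow_atTop_nhds_zero_of_lt_one (r := 1 / (Fintype.card F : ℝ))
      (by positivity) (by rw [div_lt_one] <;> linarith)).const_mul
        ((Fintype.card F : ℝ) ^ ℓ.natDegree)
    rwa [mul_zero] at this
  refine squeeze_zero (fun N => by positivity) (fun N => ?_) hlim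
  have h := le_add_div_mul hi.natDegree_pos (N + 1)
  refine card_div_le hne hcount (by omega) ((N + 1) / ℓ.natDegree) (by omega)
    (Finset.filter_subset _ _) fun v hv => ?_
  rw [(Finset.mem_filter.1 hv).2]
  exact dvd_zero _

theorem tendsto_average_multiplicity_s7 (hne : ∀ N, (V N).Nonempty) (hi : Irreducible ℓ)
    (hcount : ∀ N k, k * ℓ.natDegree ≤ N + 1 →
      ((V N).filter fun v => ℓ ^ k ∣ f v).card * Fintype.card F ^ (k * ℓ.natDegree)
        = (V N).card)
    {D : ℕ} (hdeg : ∀ N, ∀ v ∈ V N, (f v).natDegree ≤ N + D) :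
    Tendsto (fun N => (∑ v ∈ (V N).filter (fun v => f v ≠ 0), (multiplicity ℓ (f v) : ℝ)) /
      (V N).card) atTop (nhds (1 / ((Fintype.card F : ℝ) ^ ℓ.natDegree - 1))) := by
  set d := ℓ.natDegree with hd
  have hd0 : 0 < d := hi.natDegree_pos
  set q : ℝ := (Fintype.card F : ℝ) with hqdef
  have hq1 : (1 : ℝ) < q := by rw [hqdef]; exact_mod_cast Fintype.one_lt_card
  have hV : ∀ N, (0 : ℝ) < (V N).card := fun N => by exact_mod_cast (hne N).card_pos
  let c : ℕ → ℕ → ℕ := fun N k => ((V N).filter fun v => f v ≠ 0 ∧ ℓ ^ (k + 1) ∣ f v).card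
  let T : ℕ → ℕ → ℝ := fun N k => if k < N + D then (c N k : ℝ) / (V N).card else 0
  have hsum : ∀ N, (∑ v ∈ (V N).filter (fun v => f v ≠ 0), (multiplicity ℓ (f v) : ℝ)) /
      (V N).card = ∑' k, T N k := fun N => by
    rw [tsum_eq_sum (s := Finset.range (N + D)) fun k hk => if_neg (by simpa using hk)]
    rw [Finset.sum_congr rfl fun v hv => multiplicity_eq_sum hi (Finset.mem_filter.1 hv).2
      (hdeg N v (Finset.mem_filter.1 hv).1), Finset.sum_comm, Finset.sum_div]
    refine Finset.sum_congr rfl fun k hk => ?_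
    simp only [c, if_pos (Finset.mem_range.1 hk)]
    rw [Finset.sum_boole, Finset.filter_filter]
  have hr : ∀ k, 0 ≤ (1 / q) ^ k := fun k => by positivity
  have hr1 : 1 / q < 1 := by rw [div_lt_one] <;> linarith
  have hgeom : ∑' k : ℕ, ((1 / q) ^ d) ^ (k + 1) = 1 / (q ^ d - 1) := by
    have h1 : (1 / q) ^ d < 1 := pow_lt_one₀ (by positivity) hr1 hd0.ne'
    have h2 : 1 < q ^ d := one_lt_pow₀ hq1 hd0.ne'
    simp_rw [pow_succ ((1 / q) ^ d)]
    rw [tsum_mul_right, tsum_geometric_of_lt_one (hr d) h1, one_div, inv_pow]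
    have : q ^ d - 1 ≠ 0 := by linarith
    field_simp
  simp_rw [hsum]
  rw [← hgeom]
  refine tendsto_tsum_of_dominated_convergence (bound := fun k => q ^ (D + d) * (1 / q) ^ k)
    ((summable_geometric_of_lt_one (by positivity) hr1).mul_left _) (fun k => ?_)
    (Eventually.of_forall fun N k => ?_)
  · have hz := tendsto_card_filter_eq_zero_div hne hi hcount
    have := (tendsto_const_nhds (x := ((1 / q) ^ d) ^ (k + 1))).sub hz
    rw [sub_zero] at this
    refine this.congr' ?_
    filter_upwards [eventually_ge_atTop ((k + 1) * d), eventually_gt_atTop k] with N h1 h2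
    simp only [T, c, if_pos (show k < N + D by omega)]
    have hc : (((V N).filter fun v => ℓ ^ (k + 1) ∣ f v).card : ℝ) * q ^ ((k + 1) * d)
      = (V N).card := by
        rw [hqdef]; exact_mod_cast hcount N (k + 1) (by omega)
    have hsplit : ((V N).filter fun v => ℓ ^ (k + 1) ∣ f v).card =
        ((V N).filter fun v => f v = 0).card +
        ((V N).filter fun v => f v ≠ 0 ∧ ℓ ^ (k + 1) ∣ f v).card := by
      rw [← Finset.card_filter_add_card_filter_not (fun v => f v = 0), Finset.filter_filter,
        Finset.filter_filter]
      congr 2 <;> ext v <;> simp only [Finset.mem_filter] <;> constructor <;>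
        rintro ⟨ha, hb⟩
      · exact ⟨ha, hb.2⟩
      · exact ⟨ha, by rw [hb]; exact dvd_zero _, hb⟩
      · exact ⟨ha, hb.2, hb.1⟩
      · exact ⟨ha, hb.2, hb.1⟩
    have hsplit' := congrArg (Nat.cast (R := ℝ)) hsplit
    push_cast at hsplit'
    rw [sub_eq_iff_eq_add, ← add_div, add_comm (Nat.cast _), ← hsplit', eq_div_iff (hV N).ne', ← hc,
      mul_comm (k + 1) d, pow_mul, one_div_pow, one_div_pow]
    field_simp
  · rw [Real.norm_of_nonneg (by simp only [T]; split_ifs <;> positivity)]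
    simp only [T]
    split_ifs with h
    · have h' := le_add_div_mul hd0 (N + 1)
      have h'' : k + 1 ≤ (k + 1) * d := Nat.le_mul_of_pos_right _ hd0
      exact card_div_le hne hcount (by rw [← hd]; omega) (k + 1) (by rw [← hd]; omega)
        (Finset.filter_subset _ _) fun v hv => (Finset.mem_filter.1 hv).2.2
    · positivity

end Average

section Counting

open scoped Classical

variable {F : Type*} [Field F]

theorem isCoprime_mul_left_dvd {a b c e : F[X]} (h : IsCoprime a b) (ha : e ∣ c * a)
    (hb : e ∣ c * b) : e ∣ c := by
  obtain ⟨u, v, huv⟩ := h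
  have : c = u * (c * a) + v * (c * b) := by linear_combination (-c) * huv
  rw [this]
  exact dvd_add (ha.mul_left _) (hb.mul_left _)

theorem exists_monic_mul_coprime {p : F[X] × F[X]} (hp : p ≠ 0) :
    ∃ c : F[X], c.Monic ∧ ∃ p' : F[X] × F[X], IsCoprime p'.1 p'.2 ∧ c • p' = p := by
  have hg : EuclideanDomain.gcd p.1 p.2 ≠ 0 := by
    rw [Ne, EuclideanDomain.gcd_eq_zero_iff]
    exact fun h => hp (Prod.ext h.1 h.2)
  have hn : normalize (EuclideanDomain.gcd p.1 p.2) ≠ 0 := by simpa using hg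
  obtain ⟨a, ha⟩ := normalize_dvd_iff.2 (EuclideanDomain.gcd_dvd_left p.1 p.2)
  obtain ⟨b, hb⟩ := normalize_dvd_iff.2 (EuclideanDomain.gcd_dvd_right p.1 p.2)
  refine ⟨normalize (EuclideanDomain.gcd p.1 p.2), monic_normalize hg, (a, b), ?_,
    Prod.ext ha.symm hb.symm⟩
  obtain ⟨w, hw⟩ := dvd_normalize_iff.2 (dvd_refl (EuclideanDomain.gcd p.1 p.2))
  obtain ⟨w', hw'⟩ := normalize_dvd_iff.2 (dvd_refl (EuclideanDomain.gcd p.1 p.2))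
  have hbez := EuclideanDomain.gcd_eq_gcd_ab p.1 p.2
  refine ⟨w * EuclideanDomain.gcdA p.1 p.2, w * EuclideanDomain.gcdB p.1 p.2, ?_⟩
  apply mul_left_cancel₀ hn
  linear_combination (-w * EuclideanDomain.gcdA p.1 p.2) * ha
    - (w * EuclideanDomain.gcdB p.1 p.2) * hb - w * hbez - hw

/-- The linear form `(a, b) ↦ g₁ a + g₀ b`. -/
noncomputable def linForm (g₀ g₁ : F[X]) : F[X] × F[X] →ₗ[F] F[X] :=
  (LinearMap.mulLeft F g₁).coprod (LinearMap.mulLeft F g₀)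

theorem linForm_apply (g₀ g₁ : F[X]) (p : F[X] × F[X]) :
    linForm g₀ g₁ p = g₁ * p.1 + g₀ * p.2 := by
  simp [linForm]

variable [Fintype F]

theorem natCard_degreeLT (n : ℕ) : Nat.card (degreeLT F n) = Fintype.card F ^ n := by
  rw [Nat.card_congr (degreeLTEquiv F n).toEquiv]
  simp

theorem finite_degree_le (N : ℕ) : {P : F[X] | P.degree ≤ (N : WithBot ℕ)}.Finite := by
  have : Nat.card (degreeLT F (N + 1)) ≠ 0 := by
    rw [natCard_degreeLT]; exact pow_ne_zero _ Fintype.card_ne_zero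
  have := Nat.finite_of_card_ne_zero this
  refine (Set.toFinite (degreeLT F (N + 1) : Set F[X])).subset fun P hP => ?_
  rw [degreeLT_succ_eq_degreeLE]
  exact mem_degreeLE.2 hP

/-- The finite set of polynomials of degree at most `N`. -/
noncomputable def polysLE (F : Type*) [Field F] [Fintype F] (N : ℕ) : Finset F[X] :=
  (finite_degree_le N).toFinset

theorem mem_polysLE {N : ℕ} {P : F[X]} : P ∈ polysLE F N ↔ P.degree ≤ (N : WithBot ℕ) := by
  simp [polysLE]

theorem card_polysLE (N : ℕ) : (polysLE F N).card = Fintype.card F ^ (N + 1) := by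
  rw [← natCard_degreeLT, degreeLT_succ_eq_degreeLE]
  exact (Nat.subtype_card _ fun P => by rw [mem_polysLE, mem_degreeLE]).symm

/-- The pairs of polynomials of degree at most `N`. -/
noncomputable def pairsLE (F : Type*) [Field F] [Fintype F] (N : ℕ) : Finset (F[X] × F[X]) :=
  polysLE F N ×ˢ polysLE F N

theorem mem_pairsLE {N : ℕ} {p : F[X] × F[X]} :
    p ∈ pairsLE F N ↔ p.1.degree ≤ (N : WithBot ℕ) ∧ p.2.degree ≤ (N : WithBot ℕ) := by
  simp [pairsLE, mem_polysLE]

theorem card_pairsLE (N : ℕ) : (pairsLE F N).card = (Fintype.card F ^ 2) ^ (N + 1) := by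
  rw [pairsLE, Finset.card_product, card_polysLE]; ring

theorem card_filter_dvd_mul_pow {M : Type*} [AddCommGroup M] [Module F M] (V : Submodule F M)
    (s : Finset M) (hs : ∀ v, v ∈ s ↔ v ∈ V) (f : M →ₗ[F] F[X]) {m : F[X]} (hm : m.Monic)
    (hsurj : ∀ r : F[X], r.degree < m.degree → ∃ v ∈ V, f v %ₘ m = r) :
    (s.filter (fun v => m ∣ f v)).card * Fintype.card F ^ m.natDegree = s.card := by
  have hV : Nat.card V = s.card := by
    rw [Nat.subtype_card s hs]
  let φ : V →ₗ[F] F[X] := (modByMonicHom m ∘ₗ f).domRestrict V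
  have hrange : LinearMap.range φ = degreeLT F m.natDegree := by
    ext r
    rw [mem_degreeLT, ← degree_eq_natDegree hm.ne_zero]
    constructor
    · rintro ⟨v, rfl⟩
      exact degree_modByMonic_lt _ hm
    · intro hr
      obtain ⟨v, hv, h⟩ := hsurj r hr
      exact ⟨⟨v, hv⟩, h⟩
  have hker : Nat.card (LinearMap.ker φ) = (s.filter (fun v => m ∣ f v)).card := by
    have hmem : ∀ v : V, v ∈ LinearMap.ker φ ↔ m ∣ f v := fun v =>
      modByMonic_eq_zero_iff_dvd hm
    rw [Nat.card_congr (Equiv.subtypeEquivRight hmem),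
      Nat.card_congr (Equiv.subtypeSubtypeEquivSubtypeInter (· ∈ V) fun v => m ∣ f v)]
    exact Nat.subtype_card _ fun v => by rw [Finset.mem_filter, hs]
  have hq := Nat.card_congr φ.quotKerEquivRange.toEquiv
  rw [hrange, natCard_degreeLT] at hq
  rw [← hV, ← hker, ← hq, Submodule.card_eq_card_quotient_mul_card (LinearMap.ker φ), mul_comm]

/-- Multiples of a monic polynomial among the polynomials of bounded degree. -/
theorem card_polysLE_filter_dvd {N : ℕ} {m : F[X]} (hm : m.Monic) (h : m.natDegree ≤ N + 1) :
    ((polysLE F N).filter (fun v => m ∣ v)).card * Fintype.card F ^ m.natDegree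
      = (polysLE F N).card := by
  refine card_filter_dvd_mul_pow (degreeLE F N) _ (fun v => ?_) LinearMap.id hm
    fun r hr => ⟨r, ?_, ?_⟩
  · rw [mem_polysLE, mem_degreeLE]
  · rw [← degreeLT_succ_eq_degreeLE, mem_degreeLT]
    refine hr.trans_le ?_
    rw [degree_eq_natDegree hm.ne_zero]
    exact_mod_cast h
  · exact (modByMonic_eq_self_iff hm).2 hr

theorem card_pairsLE_filter_dvd {g₀ g₁ : F[X]} (hcop : IsCoprime g₀ g₁) {N : ℕ} {m : F[X]}
    (hm : m.Monic) (h : m.natDegree ≤ N + 1) :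
    ((pairsLE F N).filter (fun v => m ∣ linForm g₀ g₁ v)).card * Fintype.card F ^ m.natDegree
      = (pairsLE F N).card := by
  refine card_filter_dvd_mul_pow ((degreeLE F N).prod (degreeLE F N)) _ (fun v => ?_) _ hm
    fun r hr => ?_
  · rw [mem_pairsLE, Submodule.mem_prod, mem_degreeLE, mem_degreeLE]
  · obtain ⟨u, v, huv⟩ := hcop
    have key : ∀ x : F[X], x %ₘ m ∈ degreeLE F (N : WithBot ℕ) := fun x => by
      rw [← degreeLT_succ_eq_degreeLE, mem_degreeLT]
      refine (degree_modByMonic_lt x hm).trans_le ?_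
      rw [degree_eq_natDegree hm.ne_zero]
      exact_mod_cast h
    refine ⟨((v * r) %ₘ m, (u * r) %ₘ m), ⟨key _, key _⟩, ?_⟩
    rw [linForm_apply]
    rw [← (modByMonic_eq_self_iff hm).2 hr]
    refine (modByMonic_eq_of_dvd_sub hm ?_)
    have h1 := modByMonic_add_div (v * r) m
    have h2 := modByMonic_add_div (u * r) m
    rw [(modByMonic_eq_self_iff hm).2 hr]
    refine ⟨-(g₁ * ((v * r) /ₘ m) + g₀ * ((u * r) /ₘ m)), ?_⟩
    linear_combination g₁ * h1 + g₀ * h2 + r * huv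

theorem natDegree_linForm_le (g₀ g₁ : F[X]) {N : ℕ} {p : F[X] × F[X]} (hp : p ∈ pairsLE F N) :
    (linForm g₀ g₁ p).natDegree ≤ N + (g₀.natDegree + g₁.natDegree) := by
  rw [mem_pairsLE] at hp
  have h1 := natDegree_le_of_degree_le hp.1
  have h2 := natDegree_le_of_degree_le hp.2
  rw [linForm_apply]
  refine (natDegree_add_le _ _).trans (max_le ?_ ?_)
  · exact natDegree_mul_le.trans (by omega)
  · exact natDegree_mul_le.trans (by omega)

end Counting

section Monics

open scoped Classical

variable {F : Type*} [Field F] [Fintype F]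

theorem finite_monic_natDegree_eq (n : ℕ) : {c : F[X] | c.Monic ∧ c.natDegree = n}.Finite :=
  (finite_degree_le n).subset fun _ hc => degree_le_of_natDegree_le hc.2.le

/-- The finite set of monic polynomials of degree `n`. -/
noncomputable def monics (F : Type*) [Field F] [Fintype F] (n : ℕ) : Finset F[X] :=
  (finite_monic_natDegree_eq n).toFinset

theorem mem_monics {n : ℕ} {c : F[X]} : c ∈ monics F n ↔ c.Monic ∧ c.natDegree = n := by
  simp [monics]

theorem card_monics (n : ℕ) : (monics F n).card = Fintype.card F ^ n := by
  rw [← natCard_degreeLT, ← Nat.card_congr (monicEquivDegreeLT n)]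
  exact (Nat.subtype_card _ fun c => mem_monics).symm

/-- The total `ℓ`-adic valuation of the monic polynomials of degree `n`. -/
noncomputable def monicValSum (ℓ : F[X]) (n : ℕ) : ℝ :=
  ∑ c ∈ monics F n, (multiplicity ℓ c : ℝ)

theorem monicValSum_of_lt {ℓ : F[X]} {n : ℕ} (h : n < ℓ.natDegree) :
    monicValSum ℓ n = 0 := by
  refine Finset.sum_eq_zero fun c hc => ?_
  rw [mem_monics] at hc
  rw [Nat.cast_eq_zero]
  refine multiplicity_eq_zero.2 fun hdvd => ?_
  have := natDegree_le_of_dvd hdvd hc.1.ne_zero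
  omega

theorem monicValSum_add {ℓ : F[X]} (hm : ℓ.Monic) (hi : Irreducible ℓ) (n : ℕ) :
    monicValSum ℓ (n + ℓ.natDegree) = monicValSum ℓ n + (Fintype.card F : ℝ) ^ n := by
  have himage : (monics F n).image (ℓ * ·)
      = (monics F (n + ℓ.natDegree)).filter (ℓ ∣ ·) := by
    ext c
    simp only [Finset.mem_image, Finset.mem_filter, mem_monics]
    constructor
    · rintro ⟨b, ⟨hb, rfl⟩, rfl⟩
      exact ⟨⟨hm.mul hb, by rw [hm.natDegree_mul hb, add_comm]⟩, dvd_mul_right _ _⟩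
    · rintro ⟨⟨hc, hdeg⟩, b, rfl⟩
      have hb := hm.of_mul_monic_left hc
      exact ⟨b, ⟨hb, by rw [hm.natDegree_mul hb] at hdeg; omega⟩, rfl⟩
  rw [monicValSum, ← Finset.sum_filter_add_sum_filter_not _ (ℓ ∣ ·), ← himage,
    Finset.sum_image fun a _ b _ h => mul_left_cancel₀ hm.ne_zero h,
    Finset.sum_eq_zero (s := Finset.filter _ _) fun c hc => by
      rw [Nat.cast_eq_zero]; exact multiplicity_eq_zero.2 (Finset.mem_filter.1 hc).2, add_zero]
  have : ∀ c ∈ monics F n, (multiplicity ℓ (ℓ * c) : ℝ) = multiplicity ℓ c + 1 := by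
    intro c hc
    rw [multiplicity_mul hi.prime
      (finiteMultiplicity_of_irreducible hi (mul_ne_zero hm.ne_zero (mem_monics.1 hc).1.ne_zero)),
      multiplicity_self]
    push_cast; ring
  rw [Finset.sum_congr rfl this, Finset.sum_add_distrib, monicValSum, Finset.sum_const,
    card_monics, nsmul_one]
  push_cast; rfl

theorem monicValSum_succ {ℓ : F[X]} (hm : ℓ.Monic) (hi : Irreducible ℓ) (n : ℕ) :
    monicValSum ℓ (n + 1) - Fintype.card F * monicValSum ℓ n =
      if ℓ.natDegree ∣ n + 1 then 1 else 0 := by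
  have hd := hi.natDegree_pos
  induction n using Nat.strong_induction_on with
  | _ n ih =>
    rcases lt_trichotomy (n + 1) ℓ.natDegree with h | h | h
    · rw [monicValSum_of_lt h, monicValSum_of_lt (by omega),
        if_neg (Nat.not_dvd_of_pos_of_lt n.succ_pos h)]
      simp
    · have h1 := monicValSum_add hm hi 0
      rw [zero_add, monicValSum_of_lt hd] at h1
      rw [monicValSum_of_lt (by omega : n < _), h, h1, if_pos dvd_rfl]
      simp
    · obtain ⟨k, rfl⟩ : ∃ k, n = k + ℓ.natDegree := ⟨n - ℓ.natDegree, by omega⟩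
      have h1 := monicValSum_add hm hi (k + 1)
      have h2 := monicValSum_add hm hi k
      have h3 := ih k (by omega)
      rw [add_right_comm, h1, h2]
      simp only [Nat.dvd_add_self_right]
      rw [← h3]
      ring

/-- The coprime pairs of polynomials of degree at most `N`. -/
noncomputable def coprimeLE (F : Type*) [Field F] [Fintype F] (N : ℕ) : Finset (F[X] × F[X]) :=
  (pairsLE F N).filter fun p => IsCoprime p.1 p.2

theorem sum_pairsLE_ne_zero (H : F[X] × F[X] → ℝ) (N : ℕ) :
    ∑ p ∈ (pairsLE F N).filter (· ≠ 0), H p =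
      ∑ j ∈ Finset.range (N + 1), ∑ c ∈ monics F j, ∑ p ∈ coprimeLE F (N - j), H (c • p) := by
  simp_rw [Finset.sum_sigma']
  symm
  refine Finset.sum_bij (fun x _ => x.2.1 • x.2.2) ?_ ?_ ?_ fun _ _ => rfl
  · rintro ⟨j, c, p⟩ h
    simp only [Finset.mem_sigma, Finset.mem_range, mem_monics, coprimeLE, Finset.mem_filter,
      mem_pairsLE, ← natDegree_le_iff_degree_le] at h ⊢
    obtain ⟨hj, ⟨hc, rfl⟩, ⟨h1, h2⟩, hp⟩ := h
    refine ⟨⟨natDegree_mul_le.trans ?_, natDegree_mul_le.trans ?_⟩, ?_⟩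
    · omega
    · omega
    · refine smul_ne_zero hc.ne_zero ?_
      rintro rfl
      exact not_isCoprime_zero_zero hp
  · rintro ⟨j, c, p⟩ h ⟨j', c', p'⟩ h' heq
    simp only [Finset.mem_sigma, mem_monics, coprimeLE, Finset.mem_filter] at h h' heq
    obtain ⟨-, ⟨hc, rfl⟩, -, hp⟩ := h
    obtain ⟨-, ⟨hc', rfl⟩, -, hp'⟩ := h'
    have h1 : c * p.1 = c' * p'.1 := congrArg Prod.fst heq
    have h2 : c * p.2 = c' * p'.2 := congrArg Prod.snd heq
    have hcc : c = c' := eq_of_monic_of_associated hc hc' <| associated_of_dvd_dvd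
      (isCoprime_mul_left_dvd hp' (h1 ▸ dvd_mul_right _ _) (h2 ▸ dvd_mul_right _ _))
      (isCoprime_mul_left_dvd hp (h1 ▸ dvd_mul_right _ _) (h2 ▸ dvd_mul_right _ _))
    subst hcc
    rw [smul_right_injective _ hc.ne_zero heq]
  · intro p hp
    simp only [Finset.mem_filter, mem_pairsLE, ← natDegree_le_iff_degree_le] at hp
    obtain ⟨c, hc, p', hp', rfl⟩ := exists_monic_mul_coprime hp.2
    have key : ∀ x : F[X], x ≠ 0 → (c * x).natDegree ≤ N →
        c.natDegree ≤ N ∧ x.natDegree ≤ N - c.natDegree := fun x hx h => by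
      rw [natDegree_mul hc.ne_zero hx] at h
      omega
    have hle : c.natDegree ≤ N := by
      by_cases h1 : p'.1 = 0
      · have h2 : p'.2 ≠ 0 := fun h2 => by
          rw [h1, h2] at hp'
          exact not_isCoprime_zero_zero hp'
        exact (key _ h2 hp.1.2).1
      · exact (key _ h1 hp.1.1).1
    have key' : ∀ x : F[X], (c * x).natDegree ≤ N → x.natDegree ≤ N - c.natDegree := fun x h => by
      by_cases hx : x = 0
      · simp [hx]
      · exact (key x hx h).2
    refine ⟨⟨c.natDegree, c, p'⟩, ?_, rfl⟩
    simp only [Finset.mem_sigma, Finset.mem_range, mem_monics, coprimeLE, Finset.mem_filter,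
      mem_pairsLE, ← natDegree_le_iff_degree_le]
    exact ⟨by omega, ⟨hc, trivial⟩, ⟨key' _ hp.1.1, key' _ hp.1.2⟩, hp'⟩

end Monics

section Coprime

open scoped Classical

theorem conv_succ_sub (a h : ℕ → ℝ) (q : ℝ) (N : ℕ) :
    ∑ j ∈ Finset.range (N + 2), a j * h (N + 1 - j) -
        q * ∑ j ∈ Finset.range (N + 1), a j * h (N - j) =
      a 0 * h (N + 1) + ∑ j ∈ Finset.range (N + 1), (a (j + 1) - q * a j) * h (N - j) := by
  rw [Finset.sum_range_succ']
  simp only [Nat.add_sub_add_right, sub_mul, Finset.sum_sub_distrib, Finset.mul_sum, mul_assoc,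
    Nat.sub_zero]
  ring

theorem tsum_ite_dvd_succ {r : ℝ} (hr0 : 0 ≤ r) (hr1 : r < 1) {d : ℕ} (hd : 0 < d) :
    ∑' j : ℕ, (if d ∣ j + 1 then r ^ (j + 1) else 0) = r ^ d / (1 - r ^ d) := by
  have hinj : Function.Injective fun k : ℕ => d * (k + 1) - 1 := fun k k' h => by
    have h1 : 0 < d * (k + 1) := by positivity
    have h2 : 0 < d * (k' + 1) := by positivity
    have h3 : d * (k + 1) = d * (k' + 1) := by simp only at h; omega
    simpa using Nat.eq_of_mul_eq_mul_left hd h3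
  rw [← hinj.tsum_eq]
  · have : ∀ k : ℕ, (if d ∣ d * (k + 1) - 1 + 1 then r ^ (d * (k + 1) - 1 + 1) else 0)
        = r ^ d * (r ^ d) ^ k := fun k => by
      rw [Nat.sub_add_cancel (by positivity : 0 < d * (k + 1)), if_pos (dvd_mul_right _ _),
        pow_mul, pow_succ']
    simp_rw [this]
    rw [tsum_mul_left, tsum_geometric_of_lt_one (by positivity) (pow_lt_one₀ hr0 hr1 hd.ne'),
      div_eq_mul_inv]
  · intro j hj
    rw [Function.mem_support] at hj
    obtain ⟨k, hk⟩ : d ∣ j + 1 := by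
      by_contra h
      exact hj (if_neg h)
    have : k ≠ 0 := by rintro rfl; omega
    exact ⟨k - 1, by simp only; rw [Nat.sub_add_cancel (by omega), ← hk]; omega⟩

theorem tendsto_conv_ite_dvd_succ {Q c : ℝ} (hQ : 1 < Q) {d : ℕ} (hd : 0 < d) {h : ℕ → ℝ}
    (hh : Tendsto (fun N => h N / Q ^ (N + 1)) atTop (nhds c))
    (hb : ∀ N, |h N / Q ^ (N + 1)| ≤ 1) :
    Tendsto (fun N => (∑ j ∈ Finset.range (N + 1), (if d ∣ j + 1 then 1 else 0) * h (N - j)) /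
      Q ^ (N + 2)) atTop (nhds (c / (Q ^ d - 1))) := by
  have hQ0 : 0 < Q := by linarith
  have hr1 : Q⁻¹ < 1 := inv_lt_one_of_one_lt₀ hQ
  let T : ℕ → ℕ → ℝ := fun N j => if j < N + 1 then
    (if d ∣ j + 1 then Q⁻¹ ^ (j + 1) else 0) * (h (N - j) / Q ^ (N - j + 1)) else 0
  have hsum : ∀ N, (∑ j ∈ Finset.range (N + 1), (if d ∣ j + 1 then 1 else 0) * h (N - j)) /
      Q ^ (N + 2) = ∑' j, T N j := fun N => by
    rw [tsum_eq_sum (s := Finset.range (N + 1)) fun k hk => if_neg (by simpa using hk),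
      Finset.sum_div]
    refine Finset.sum_congr rfl fun j hj => ?_
    rw [Finset.mem_range] at hj
    simp only [if_pos hj]
    have hp : Q ^ (N + 2) = Q ^ (j + 1) * Q ^ (N - j + 1) := by
      rw [← pow_add]; congr 1; omega
    split_ifs
    · rw [hp, inv_pow]; field_simp
    · simp
  have hlim : c / (Q ^ d - 1) = ∑' j : ℕ, (if d ∣ j + 1 then Q⁻¹ ^ (j + 1) else 0) * c := by
    rw [tsum_mul_right, tsum_ite_dvd_succ (by positivity) hr1 hd, inv_pow]
    have : 1 < Q ^ d := one_lt_pow₀ hQ hd.ne'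
    have : Q ^ d - 1 ≠ 0 := by linarith
    field_simp
  simp_rw [hsum]
  rw [hlim]
  refine tendsto_tsum_of_dominated_convergence (bound := fun k => Q⁻¹ ^ k)
    (summable_geometric_of_lt_one (by positivity) hr1) (fun k => ?_)
    (Eventually.of_forall fun N k => ?_)
  · refine ((hh.comp (tendsto_sub_atTop_nat k)).const_mul _).congr' ?_
    filter_upwards [eventually_ge_atTop k] with N hN
    simp only [T, if_pos (show k < N + 1 by omega), Function.comp]
  · rw [Real.norm_eq_abs]
    simp only [T]
    split_ifs
    · rw [abs_mul, abs_of_nonneg (by positivity), ← mul_one (Q⁻¹ ^ k)]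
      exact mul_le_mul (pow_le_pow_of_le_one (by positivity) hr1.le k.le_succ) (hb _)
        (abs_nonneg _) (by positivity)
    · simp only [zero_mul, abs_zero]; positivity
    · simp only [abs_zero]; positivity

variable {F : Type*} [Field F] [Fintype F]

theorem one_lt_card_cast (F : Type*) [Field F] [Fintype F] : (1 : ℝ) < Fintype.card F := by
  exact_mod_cast Fintype.one_lt_card

theorem card_coprimeLE_succ (N : ℕ) :
    ((coprimeLE F (N + 1)).card : ℝ) = ((Fintype.card F : ℝ) ^ 2) ^ (N + 2) - 1 -
      Fintype.card F * (((Fintype.card F : ℝ) ^ 2) ^ (N + 1) - 1) := by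
  have key : ∀ N : ℕ, ((Fintype.card F : ℝ) ^ 2) ^ (N + 1) - 1 =
      ∑ j ∈ Finset.range (N + 1), (Fintype.card F : ℝ) ^ j * (coprimeLE F (N - j)).card := by
    intro N
    have h := sum_pairsLE_ne_zero (F := F) (fun _ => 1) N
    have h0 : (0 : F[X] × F[X]) ∈ pairsLE F N := by simp [mem_pairsLE]
    simp only [Finset.sum_const, Finset.filter_ne', Finset.card_erase_of_mem h0,
      card_pairsLE, card_monics, nsmul_eq_mul] at h
    rw [Nat.cast_sub (Nat.one_le_pow _ _ (by have := Fintype.card_pos (α := F); positivity))] at h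
    push_cast at h
    simpa only [mul_one] using h
  have h := conv_succ_sub (fun j => (Fintype.card F : ℝ) ^ j)
    (fun M => ((coprimeLE F M).card : ℝ)) (Fintype.card F) N
  simp only [pow_succ' (Fintype.card F : ℝ), sub_self, zero_mul, Finset.sum_const_zero,
    pow_zero, one_mul, add_zero] at h
  rw [key N, key (N + 1), h]

theorem tendsto_card_coprimeLE :
    Tendsto (fun N => ((coprimeLE F N).card : ℝ) / ((Fintype.card F : ℝ) ^ 2) ^ (N + 1)) atTop
      (nhds (1 - 1 / (Fintype.card F : ℝ))) := by
  rw [← tendsto_add_atTop_iff_nat 1]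
  set q : ℝ := (Fintype.card F : ℝ) with hq
  have hq1 : 1 < q := one_lt_card_cast F
  have hQ : 1 < q ^ 2 := one_lt_pow₀ hq1 two_ne_zero
  have hz : Tendsto (fun N : ℕ => (q ^ 2)⁻¹ ^ (N + 1)) atTop (nhds 0) :=
    (tendsto_pow_atTop_nhds_zero_of_lt_one (by positivity) (inv_lt_one_of_one_lt₀ hQ)).comp
      (tendsto_add_atTop_nat 1)
  have : Tendsto (fun N : ℕ => (1 - 1 / q) + (q ^ 2)⁻¹ ^ (N + 1) * ((q - 1) / q ^ 2)) atTop
      (nhds (1 - 1 / q + 0 * ((q - 1) / q ^ 2))) := (hz.mul_const _).const_add _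
  rw [zero_mul, add_zero] at this
  refine this.congr fun N => ?_
  rw [card_coprimeLE_succ, ← hq, inv_pow]
  have : q ≠ 0 := by positivity
  field_simp
  ring

variable {g₀ g₁ ℓ : F[X]}

theorem pairsLE_nonempty (N : ℕ) : (pairsLE F N).Nonempty :=
  ⟨0, by simp [mem_pairsLE]⟩

theorem card_pairsLE_filter_pow_dvd (hcop : IsCoprime g₀ g₁) (hm : ℓ.Monic) (N k : ℕ)
    (h : k * ℓ.natDegree ≤ N + 1) :
    ((pairsLE F N).filter fun p => ℓ ^ k ∣ linForm g₀ g₁ p).card *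
      Fintype.card F ^ (k * ℓ.natDegree) = (pairsLE F N).card := by
  rw [← natDegree_pow] at h ⊢
  exact card_pairsLE_filter_dvd hcop (hm.pow k) h

theorem card_pairsLE_cast (N : ℕ) :
    ((pairsLE F N).card : ℝ) = ((Fintype.card F : ℝ) ^ 2) ^ (N + 1) := by
  rw [card_pairsLE]; push_cast; rfl

theorem tendsto_card_coprimeLE_filter (hcop : IsCoprime g₀ g₁) (hm : ℓ.Monic)
    (hi : Irreducible ℓ) :
    Tendsto (fun N => (((coprimeLE F N).filter fun p => linForm g₀ g₁ p ≠ 0).card : ℝ) /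
      ((Fintype.card F : ℝ) ^ 2) ^ (N + 1)) atTop (nhds (1 - 1 / (Fintype.card F : ℝ))) := by
  have hz := tendsto_card_filter_eq_zero_div pairsLE_nonempty hi
    (card_pairsLE_filter_pow_dvd hcop hm)
  simp_rw [card_pairsLE_cast] at hz
  have hz' : Tendsto (fun N => (((coprimeLE F N).filter fun p => linForm g₀ g₁ p = 0).card : ℝ) /
      ((Fintype.card F : ℝ) ^ 2) ^ (N + 1)) atTop (nhds 0) := by
    refine squeeze_zero (fun N => by positivity) (fun N => ?_) hz
    gcongr
    exact Finset.filter_subset _ _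
  have := (tendsto_card_coprimeLE (F := F)).sub hz'
  rw [sub_zero] at this
  refine this.congr fun N => ?_
  rw [← Finset.card_filter_add_card_filter_not (s := coprimeLE F N)
    (fun p => linForm g₀ g₁ p = 0)]
  push_cast
  ring

/-- The total `ℓ`-adic valuation of the nonzero values of a linear form on a finite set of pairs. -/
noncomputable def valSum (g₀ g₁ ℓ : F[X]) (s : Finset (F[X] × F[X])) : ℝ :=
  ∑ p ∈ s.filter (fun p => linForm g₀ g₁ p ≠ 0), (multiplicity ℓ (linForm g₀ g₁ p) : ℝ)

theorem valSum_pairsLE (hi : Irreducible ℓ) (N : ℕ) :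
    valSum g₀ g₁ ℓ (pairsLE F N) =
      ∑ j ∈ Finset.range (N + 1), monicValSum ℓ j *
        ((coprimeLE F (N - j)).filter fun p => linForm g₀ g₁ p ≠ 0).card +
      ∑ j ∈ Finset.range (N + 1), (Fintype.card F : ℝ) ^ j *
        valSum g₀ g₁ ℓ (coprimeLE F (N - j)) := by
  have h := sum_pairsLE_ne_zero (F := F) (fun p => if linForm g₀ g₁ p ≠ 0 then
    (multiplicity ℓ (linForm g₀ g₁ p) : ℝ) else 0) N
  have hl : valSum g₀ g₁ ℓ (pairsLE F N) = ∑ p ∈ (pairsLE F N).filter (· ≠ 0),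
      if linForm g₀ g₁ p ≠ 0 then (multiplicity ℓ (linForm g₀ g₁ p) : ℝ) else 0 := by
    rw [← Finset.sum_filter, Finset.filter_filter, valSum]
    refine Finset.sum_congr (Finset.filter_congr fun p _ => ?_) fun _ _ => rfl
    exact ⟨fun hp => ⟨by rintro rfl; exact hp (map_zero _), hp⟩, fun hp => hp.2⟩
  rw [hl, h, ← Finset.sum_add_distrib]
  refine Finset.sum_congr rfl fun j _ => ?_
  have hc : ∀ c ∈ monics F j, (∑ p ∈ coprimeLE F (N - j), if linForm g₀ g₁ (c • p) ≠ 0 then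
      (multiplicity ℓ (linForm g₀ g₁ (c • p)) : ℝ) else 0) =
      multiplicity ℓ c * ((coprimeLE F (N - j)).filter fun p => linForm g₀ g₁ p ≠ 0).card +
        valSum g₀ g₁ ℓ (coprimeLE F (N - j)) := by
    intro c hc
    have hc0 := (mem_monics.1 hc).1.ne_zero
    have hlin : ∀ p, linForm g₀ g₁ (c • p) = c * linForm g₀ g₁ p := fun p => by
      simp only [linForm_apply, Prod.smul_fst, Prod.smul_snd, smul_eq_mul]; ring
    simp_rw [hlin, mul_ne_zero_iff_left hc0]
    rw [← Finset.sum_filter, valSum, mul_comm, ← nsmul_eq_mul, ← Finset.sum_const,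
      ← Finset.sum_add_distrib]
    refine Finset.sum_congr rfl fun p hp => ?_
    rw [multiplicity_mul hi.prime (finiteMultiplicity_of_irreducible hi
      (mul_ne_zero hc0 (Finset.mem_filter.1 hp).2))]
    push_cast; rfl
  rw [Finset.sum_congr rfl hc, Finset.sum_add_distrib, Finset.sum_const, card_monics,
    ← Finset.sum_mul, monicValSum, nsmul_eq_mul]
  push_cast; rfl

theorem valSum_coprimeLE_succ (hm : ℓ.Monic) (hi : Irreducible ℓ) (N : ℕ) :
    valSum g₀ g₁ ℓ (coprimeLE F (N + 1)) =
      valSum g₀ g₁ ℓ (pairsLE F (N + 1)) - Fintype.card F * valSum g₀ g₁ ℓ (pairsLE F N) -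
      ∑ j ∈ Finset.range (N + 1), (if ℓ.natDegree ∣ j + 1 then 1 else 0) *
        (((coprimeLE F (N - j)).filter fun p => linForm g₀ g₁ p ≠ 0).card : ℝ) := by
  have h1 := conv_succ_sub (monicValSum ℓ)
    (fun M => (((coprimeLE F M).filter fun p => linForm g₀ g₁ p ≠ 0).card : ℝ))
    (Fintype.card F) N
  have h2 := conv_succ_sub (fun j => (Fintype.card F : ℝ) ^ j)
    (fun M => valSum g₀ g₁ ℓ (coprimeLE F M)) (Fintype.card F) N
  simp only [monicValSum_succ hm hi, monicValSum_of_lt hi.natDegree_pos] at h1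
  simp only [pow_succ', sub_self, zero_mul, Finset.sum_const_zero, pow_zero] at h2
  rw [valSum_pairsLE hi, valSum_pairsLE hi]
  linarith

theorem tendsto_valSum_pairsLE (hcop : IsCoprime g₀ g₁) (hm : ℓ.Monic) (hi : Irreducible ℓ) :
    Tendsto (fun N => valSum g₀ g₁ ℓ (pairsLE F N) / ((Fintype.card F : ℝ) ^ 2) ^ (N + 1)) atTop
      (nhds (1 / ((Fintype.card F : ℝ) ^ ℓ.natDegree - 1))) := by
  have := tendsto_average_multiplicity_s7 pairsLE_nonempty hi
    (card_pairsLE_filter_pow_dvd hcop hm) fun N p hp => natDegree_linForm_le g₀ g₁ hp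
  simp_rw [card_pairsLE_cast] at this
  exact this

theorem tendsto_average_coprimeLE (hcop : IsCoprime g₀ g₁) (hm : ℓ.Monic) (hi : Irreducible ℓ) :
    Tendsto (fun N => valSum g₀ g₁ ℓ (coprimeLE F N) /
      ((coprimeLE F N).filter fun p => linForm g₀ g₁ p ≠ 0).card) atTop
      (nhds (1 / ((Fintype.card F : ℝ) ^ ℓ.natDegree - 1) -
        1 / (((Fintype.card F : ℝ) ^ 2) ^ ℓ.natDegree - 1))) := by
  have hC := tendsto_card_coprimeLE_filter hcop hm hi
  have hS := tendsto_valSum_pairsLE hcop hm hi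
  set q : ℝ := (Fintype.card F : ℝ) with hq
  have hq1 : 1 < q := one_lt_card_cast F
  have hQ : 1 < q ^ 2 := one_lt_pow₀ hq1 two_ne_zero
  have hb : ∀ N, |(((coprimeLE F N).filter fun p => linForm g₀ g₁ p ≠ 0).card : ℝ) /
      (q ^ 2) ^ (N + 1)| ≤ 1 := fun N => by
    rw [abs_of_nonneg (by positivity), ← card_pairsLE_cast]
    refine div_le_one_of_le₀ ?_ (by positivity)
    exact_mod_cast Finset.card_le_card
      ((Finset.filter_subset _ _).trans (Finset.filter_subset _ _))
  have hK := tendsto_conv_ite_dvd_succ hQ hi.natDegree_pos hC hb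
  have hq0 : 1 - 1 / q ≠ 0 := by
    have : 1 / q < 1 := by rw [div_lt_one] <;> linarith
    linarith
  have hnum : Tendsto (fun N => valSum g₀ g₁ ℓ (coprimeLE F N) / (q ^ 2) ^ (N + 1)) atTop
      (nhds (1 / (q ^ ℓ.natDegree - 1) - 1 / q * (1 / (q ^ ℓ.natDegree - 1)) -
        (1 - 1 / q) / ((q ^ 2) ^ ℓ.natDegree - 1))) := by
    rw [← tendsto_add_atTop_iff_nat 1]
    refine ((((tendsto_add_atTop_iff_nat 1).2 hS).sub (hS.const_mul (1 / q))).sub hK).congr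
      fun N => ?_
    rw [valSum_coprimeLE_succ hm hi]
    have : q ≠ 0 := by positivity
    rw [← hq]
    field_simp
    ring
  have := hnum.div hC hq0
  have heq : (1 / (q ^ ℓ.natDegree - 1) - 1 / q * (1 / (q ^ ℓ.natDegree - 1)) -
        (1 - 1 / q) / ((q ^ 2) ^ ℓ.natDegree - 1)) / (1 - 1 / q) =
      1 / (q ^ ℓ.natDegree - 1) - 1 / ((q ^ 2) ^ ℓ.natDegree - 1) := by
    rw [div_eq_iff hq0]; ring
  rw [heq] at this
  refine this.congr fun N => ?_
  exact div_div_div_cancel_right₀ (by positivity) _ _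

end Coprime

section Primes

open scoped Classical

variable {F : Type*} [Field F] [Fintype F]

/-- The monic irreducible polynomials of degree `d`. -/
noncomputable def monicIrreducibles (F : Type*) [Field F] [Fintype F] (d : ℕ) : Finset F[X] :=
  (monics F d).filter Irreducible

theorem mem_monicIrreducibles {d : ℕ} {ℓ : F[X]} :
    ℓ ∈ monicIrreducibles F d ↔ ℓ.Monic ∧ Irreducible ℓ ∧ ℓ.natDegree = d := by
  rw [monicIrreducibles, Finset.mem_filter, mem_monics]; tauto

theorem disjoint_monicIrreducibles {d e : ℕ} (h : d ≠ e) :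
    Disjoint (monicIrreducibles F d) (monicIrreducibles F e) := by
  refine Finset.disjoint_left.2 fun ℓ h1 h2 => h ?_
  rw [← (mem_monicIrreducibles.1 h1).2.2, ← (mem_monicIrreducibles.1 h2).2.2]

theorem squarefree_X_pow_card_pow_sub_X {n : ℕ} (hn : n ≠ 0) :
    Squarefree (X ^ Fintype.card F ^ n - X : F[X]) := by
  obtain ⟨p, hp⟩ := CharP.exists F
  refine (galois_poly_separable p _ (dvd_pow ?_ hn)).squarefree
  rw [← CharP.cast_eq_zero_iff F p]
  exact Nat.cast_card_eq_zero F

/-- The Gauss count of monic irreducible polynomials over a finite field. -/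
theorem sum_divisors_card_monicIrreducibles_mul {n : ℕ} (hn : n ≠ 0) :
    ∑ d ∈ n.divisors, (monicIrreducibles F d).card * d = Fintype.card F ^ n := by
  have hP0 : (X ^ Fintype.card F ^ n - X : F[X]) ≠ 0 :=
    FiniteField.X_pow_card_pow_sub_X_ne_zero F hn Fintype.one_lt_card
  have hnodup := (UniqueFactorizationMonoid.squarefree_iff_nodup_normalizedFactors hP0).1
    (squarefree_X_pow_card_pow_sub_X hn)
  rw [← FiniteField.X_pow_card_pow_sub_X_natDegree_eq F hn Fintype.one_lt_card]
  set P : F[X] := X ^ Fintype.card F ^ n - X with hP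
  set M := UniqueFactorizationMonoid.normalizedFactors P with hM
  have hdeg : P.natDegree = (M.map natDegree).sum := by
    rw [← natDegree_multiset_prod _ (UniqueFactorizationMonoid.zero_notMem_normalizedFactors P)]
    exact natDegree_eq_of_degree_eq (degree_eq_degree_of_associated
      (UniqueFactorizationMonoid.prod_normalizedFactors hP0)).symm
  have hset : M.toFinset = n.divisors.biUnion (monicIrreducibles F) := by
    ext ℓ
    simp only [Multiset.mem_toFinset, Finset.mem_biUnion, mem_monicIrreducibles,
      Nat.mem_divisors, hM, Polynomial.mem_normalizedFactors_iff hP0]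
    constructor
    · rintro ⟨hi, hm, hdvd⟩
      rw [hP, ← Nat.card_eq_fintype_card,
        ← hi.natDegree_dvd_iff_dvd_X_pow_card_pow_sub_X] at hdvd
      exact ⟨_, ⟨hdvd, hn⟩, hm, hi, rfl⟩
    · rintro ⟨d, ⟨hd, -⟩, hm, hi, rfl⟩
      refine ⟨hi, hm, ?_⟩
      rwa [hP, ← Nat.card_eq_fintype_card, ← hi.natDegree_dvd_iff_dvd_X_pow_card_pow_sub_X]
  rw [hdeg, ← hnodup.dedup, ← Multiset.toFinset_val, ← Finset.sum_eq_multiset_sum, hset,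
    Finset.sum_biUnion fun d _ e _ h => disjoint_monicIrreducibles h]
  refine Finset.sum_congr rfl fun d _ => ?_
  rw [Finset.sum_congr rfl fun ℓ hℓ => (mem_monicIrreducibles.1 hℓ).2.2, Finset.sum_const,
    smul_eq_mul]

theorem hasSum_inv_pow_pnat {x : ℝ} (hx : 1 < x) :
    HasSum (fun n : ℕ+ => (x⁻¹) ^ (n : ℕ)) (1 / (x - 1)) := by
  rw [← Equiv.pnatEquivNat.symm.hasSum_iff]
  have h := (hasSum_geometric_of_lt_one (r := x⁻¹) (by positivity)
    (inv_lt_one_of_one_lt₀ hx)).mul_left x⁻¹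
  have h1 : x - 1 ≠ 0 := by linarith
  have heq : x⁻¹ * (1 - x⁻¹)⁻¹ = 1 / (x - 1) := by
    have : x ≠ 0 := by positivity
    field_simp
  rw [heq] at h
  refine h.congr_fun fun n => ?_
  simp [pow_succ', mul_comm]

theorem hasSum_monicIrreducibles :
    HasSum (fun d : ℕ+ => ((monicIrreducibles F d).card * d : ℝ) *
      (1 / (((Fintype.card F : ℝ) ^ 2) ^ (d : ℕ) - 1))) (1 / ((Fintype.card F : ℝ) - 1)) := by
  have hq1 := one_lt_card_cast F
  set q : ℝ := (Fintype.card F : ℝ) with hq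
  have hQ : 1 < q ^ 2 := one_lt_pow₀ hq1 two_ne_zero
  let T : ℕ+ × ℕ+ → ℝ := fun x =>
    ((monicIrreducibles F x.1).card * (x.1 : ℕ) : ℝ) * ((q ^ 2) ^ (x.1 : ℕ))⁻¹ ^ (x.2 : ℕ)
  have hfib : ∀ n : ℕ+, HasSum (fun x : Nat.divisorsAntidiagonal n =>
      (T ∘ sigmaAntidiagonalEquivProd) ⟨n, x⟩) (q⁻¹ ^ (n : ℕ)) := fun n => by
    have hx : ∀ x : Nat.divisorsAntidiagonal n, (T ∘ sigmaAntidiagonalEquivProd) ⟨n, x⟩ =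
        ((monicIrreducibles F x.1.1).card * x.1.1 : ℝ) * (q ^ 2)⁻¹ ^ (n : ℕ) := by
      intro x
      have := (Nat.mem_divisorsAntidiagonal.1 x.2).1
      simp only [Function.comp, T, sigmaAntidiagonalEquivProd, Equiv.coe_fn_mk,
        divisorsAntidiagonalFactors, PNat.mk_coe]
      rw [← inv_pow, ← pow_mul, this]
    simp_rw [hx]
    convert hasSum_fintype _ using 1
    rw [← Finset.sum_mul, Finset.sum_coe_sort (Nat.divisorsAntidiagonal n)
      (fun x => ((monicIrreducibles F x.1).card * x.1 : ℝ)),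
      Nat.sum_divisorsAntidiagonal (fun d _ => ((monicIrreducibles F d).card * d : ℝ))]
    have h := congrArg (Nat.cast (R := ℝ)) (sum_divisors_card_monicIrreducibles_mul (F := F) n.ne_zero)
    push_cast at h
    rw [h, ← hq, ← mul_pow]
    congr 1
    field_simp
  have hsum : Summable (T ∘ sigmaAntidiagonalEquivProd) := by
    rw [summable_sigma_of_nonneg fun x => by simp only [Function.comp, T]; positivity]
    refine ⟨fun n => (hfib n).summable, ?_⟩
    simp_rw [fun n => (hfib n).tsum_eq]
    exact (hasSum_inv_pow_pnat hq1).summable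
  have hT : HasSum T (1 / (q - 1)) := by
    rw [← sigmaAntidiagonalEquivProd.hasSum_iff]
    exact (hasSum_inv_pow_pnat hq1).sigma_of_hasSum hfib hsum
  refine hT.prod_fiberwise fun d => ?_
  exact (hasSum_inv_pow_pnat (one_lt_pow₀ hQ d.ne_zero)).mul_left _

theorem tendsto_finsum_monic_irreducible :
    Tendsto (fun b : ℕ =>
      ∑ᶠ ℓ ∈ {ℓ : F[X] | ℓ.Monic ∧ Irreducible ℓ ∧ ℓ.degree ≤ (b : WithBot ℕ)},
        (ℓ.natDegree : ℝ) * (1 / (((Fintype.card F : ℝ) ^ 2) ^ ℓ.natDegree - 1)))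
      atTop (nhds (1 / ((Fintype.card F : ℝ) - 1))) := by
  have h := hasSum_monicIrreducibles (F := F)
  rw [← Equiv.pnatEquivNat.symm.hasSum_iff] at h
  refine h.tendsto_sum_nat.congr fun b => ?_
  have hset : {ℓ : F[X] | ℓ.Monic ∧ Irreducible ℓ ∧ ℓ.degree ≤ (b : WithBot ℕ)} =
      ((Finset.range b).biUnion fun d => monicIrreducibles F (d + 1) : Finset F[X]) := by
    ext ℓ
    simp only [Set.mem_ofPred_eq, Finset.mem_coe, Finset.mem_biUnion, Finset.mem_range,
      mem_monicIrreducibles, ← natDegree_le_iff_degree_le]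
    constructor
    · rintro ⟨hm, hi, hd⟩
      have := hi.natDegree_pos
      exact ⟨ℓ.natDegree - 1, by omega, hm, hi, by omega⟩
    · rintro ⟨d, hd, hm, hi, hdeg⟩
      exact ⟨hm, hi, by omega⟩
  rw [hset, finsum_mem_coe_finset, Finset.sum_biUnion fun d _ e _ h =>
    disjoint_monicIrreducibles (by simpa using h)]
  refine Finset.sum_congr rfl fun d _ => ?_
  rw [Finset.sum_congr rfl fun ℓ hℓ => by rw [(mem_monicIrreducibles.1 hℓ).2.2],
    Finset.sum_const, nsmul_eq_mul]
  simp [mul_assoc]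

end Primes

section LocalAverages

open scoped Classical

variable {F : Type*} [Field F] [Fintype F] {g₀ g₁ ℓ : F[X]}

theorem tendsto_average_polynomials (hm : ℓ.Monic) (hi : Irreducible ℓ) :
    Tendsto (fun N : ℕ =>
      (∑ᶠ P ∈ {P : F[X] | P ≠ 0 ∧ P.degree ≤ (N : WithBot ℕ)}, (multiplicity ℓ P : ℝ)) /
        (({P : F[X] | P ≠ 0 ∧ P.degree ≤ (N : WithBot ℕ)}).ncard : ℝ))
      atTop (nhds (1 / ((Fintype.card F : ℝ) ^ ℓ.natDegree - 1))) := by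
  have hne : ∀ N, (polysLE F N).Nonempty := fun N => ⟨0, by simp [mem_polysLE]⟩
  have hcount : ∀ N k, k * ℓ.natDegree ≤ N + 1 →
      ((polysLE F N).filter fun v => ℓ ^ k ∣ v).card * Fintype.card F ^ (k * ℓ.natDegree)
        = (polysLE F N).card := fun N k h => by
    rw [← natDegree_pow] at h ⊢
    exact card_polysLE_filter_dvd (hm.pow k) h
  have hS := tendsto_average_multiplicity_s7 (f := fun P : F[X] => P) (D := 0) hne hi hcount
    fun N v hv => natDegree_le_of_degree_le (mem_polysLE.1 hv)
  have hz := tendsto_card_filter_eq_zero_div (f := fun P : F[X] => P) hne hi hcount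
  have hr := hS.div ((tendsto_const_nhds (x := (1 : ℝ))).sub hz) (by simp)
  rw [sub_zero, div_one] at hr
  refine hr.congr fun N => ?_
  have hset : {P : F[X] | P ≠ 0 ∧ P.degree ≤ (N : WithBot ℕ)} =
      ((polysLE F N).filter fun P => P ≠ 0 : Finset F[X]) := by
    ext P
    simp [mem_polysLE, and_comm]
  rw [hset, finsum_mem_coe_finset, Set.ncard_coe_finset]
  have hcard : (((polysLE F N).filter fun P => P ≠ 0).card : ℝ) =
      (polysLE F N).card - ((polysLE F N).filter fun P => P = 0).card := by
    rw [← Finset.card_filter_add_card_filter_not (s := polysLE F N) (fun P => P = 0)]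
    push_cast; ring
  have hpos : ((polysLE F N).card : ℝ) ≠ 0 := by exact_mod_cast (hne N).card_pos.ne'
  rw [hcard, ← div_div_div_cancel_right₀ hpos, sub_div, div_self hpos]
  rfl

theorem tendsto_average_coprime_pairs (hcop : IsCoprime g₀ g₁) (hm : ℓ.Monic)
    (hi : Irreducible ℓ) :
    Tendsto (fun N : ℕ =>
      (∑ᶠ ab ∈ {ab : F[X] × F[X] | IsCoprime ab.1 ab.2 ∧ g₁ * ab.1 + g₀ * ab.2 ≠ 0 ∧
          ab.1.degree ≤ (N : WithBot ℕ) ∧ ab.2.degree ≤ (N : WithBot ℕ)},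
        (multiplicity ℓ (g₁ * ab.1 + g₀ * ab.2) : ℝ)) /
      (({ab : F[X] × F[X] | IsCoprime ab.1 ab.2 ∧ g₁ * ab.1 + g₀ * ab.2 ≠ 0 ∧
          ab.1.degree ≤ (N : WithBot ℕ) ∧ ab.2.degree ≤ (N : WithBot ℕ)}).ncard : ℝ))
      atTop (nhds (1 / ((Fintype.card F : ℝ) ^ ℓ.natDegree - 1) -
        1 / (((Fintype.card F : ℝ) ^ 2) ^ ℓ.natDegree - 1))) := by
  refine (tendsto_average_coprimeLE hcop hm hi).congr fun N => ?_
  have hset : {ab : F[X] × F[X] | IsCoprime ab.1 ab.2 ∧ g₁ * ab.1 + g₀ * ab.2 ≠ 0 ∧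
      ab.1.degree ≤ (N : WithBot ℕ) ∧ ab.2.degree ≤ (N : WithBot ℕ)} =
      ((coprimeLE F N).filter fun p => linForm g₀ g₁ p ≠ 0 : Finset (F[X] × F[X])) := by
    ext p
    simp only [Set.mem_ofPred_eq, Finset.mem_coe, Finset.mem_filter, coprimeLE, mem_pairsLE,
      linForm_apply]
    tauto
  rw [hset, finsum_mem_coe_finset, Set.ncard_coe_finset, valSum]
  simp_rw [linForm_apply]

end LocalAverages

/-- (Theorem `alpha_x`.)  For a linear polynomial `g = g₁ x + g₀` (with
`g₁ ≠ 0`, `gcd(g₀,g₁) = 1`, and homogenization `G(a,b) = g₁ a + g₀ b`), the local values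
`α_ℓ(g) = deg ℓ · (A₁(ℓ) - A₂(ℓ))` exist for every monic irreducible `ℓ`, and their sum
over `ℓ` of degree at most `b₀` tends to `1/(q-1)` as `b₀ → ∞`. -/
theorem alpha_linear_polynomial
    (Fq : Type*) [Field Fq] [Fintype Fq]
    (g₀ g₁ : Polynomial Fq) (hg₁ : g₁ ≠ 0) (hcop : IsCoprime g₀ g₁) :
    ∃ αl : Polynomial Fq → ℝ,
      (∀ ℓ : Polynomial Fq, ℓ.Monic → Irreducible ℓ →
        ∃ A₁ A₂ : ℝ,
          Filter.Tendsto (fun N : ℕ =>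
              (∑ᶠ P ∈ {P : Polynomial Fq | P ≠ 0 ∧ P.degree ≤ (N : WithBot ℕ)},
                (multiplicity ℓ P : ℝ)) /
              (({P : Polynomial Fq | P ≠ 0 ∧ P.degree ≤ (N : WithBot ℕ)}).ncard : ℝ))
            Filter.atTop (nhds A₁) ∧
          Filter.Tendsto (fun N : ℕ =>
              (∑ᶠ ab ∈ {ab : Polynomial Fq × Polynomial Fq | IsCoprime ab.1 ab.2 ∧
                  g₁ * ab.1 + g₀ * ab.2 ≠ 0 ∧
                  ab.1.degree ≤ (N : WithBot ℕ) ∧ ab.2.degree ≤ (N : WithBot ℕ)},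
                (multiplicity ℓ (g₁ * ab.1 + g₀ * ab.2) : ℝ)) /
              (({ab : Polynomial Fq × Polynomial Fq | IsCoprime ab.1 ab.2 ∧
                  g₁ * ab.1 + g₀ * ab.2 ≠ 0 ∧
                  ab.1.degree ≤ (N : WithBot ℕ) ∧ ab.2.degree ≤ (N : WithBot ℕ)}).ncard : ℝ))
            Filter.atTop (nhds A₂) ∧
          αl ℓ = (ℓ.natDegree : ℝ) * (A₁ - A₂)) ∧
      Filter.Tendsto (fun b₀ : ℕ =>
          ∑ᶠ ℓ ∈ {ℓ : Polynomial Fq | ℓ.Monic ∧ Irreducible ℓ ∧ ℓ.degree ≤ (b₀ : WithBot ℕ)},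
            αl ℓ)
        Filter.atTop (nhds (1 / ((Fintype.card Fq : ℝ) - 1))) := by
  refine ⟨fun ℓ => (ℓ.natDegree : ℝ) * (1 / (((Fintype.card Fq : ℝ) ^ 2) ^ ℓ.natDegree - 1)),
    fun ℓ hm hi => ⟨_, _, tendsto_average_polynomials hm hi,
      tendsto_average_coprime_pairs hcop hm hi, ?_⟩, tendsto_finsum_monic_irreducible⟩
  rw [sub_sub_cancel]
end
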